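/- Hochster's theorem: let R be a Cohen–Macaulay noetherian ring and M a fine, sharp and saturated monoid. Then the monoid algebra R[M] is Cohen–Macaulay. -/

import Mathlib

/-- A noetherian local ring is Cohen–Macaulay if its maximal ideal contains a regular
sequence of length equal to its Krull dimension (i.e. depth = dimension). -/
def IsCohenMacaulayLocalRing (R : Type*) [CommRing R] [IsLocalRing R] : Prop :=
  ∃ rs : List R, (∀ x ∈ rs, x ∈ IsLocalRing.maximalIdeal R) ∧
    RingTheory.Sequence.IsRegular R rs ∧ (rs.length : WithBot (WithTop ℕ)) = ringKrullDim R

/-- A (noetherian) commutative ring is Cohen–Macaulay if all its localizations at prime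
ideals are Cohen–Macaulay local rings. -/
def IsCohenMacaulayRing (R : Type*) [CommRing R] : Prop :=
  ∀ p : Ideal R, ∀ hp : p.IsPrime,
    letI := hp
    IsCohenMacaulayLocalRing (Localization.AtPrime p)

/-- A commutative monoid is saturated if it is root-closed in its groupification: whenever
`aⁿ` is divisible by `bⁿ` (for some `n ≥ 1`), `a` is divisible by `b`. -/
def IsSaturatedMonoid (P : Type*) [CommMonoid P] : Prop :=
  ∀ a b : P, ∀ n : ℕ, 0 < n → (∃ c, a ^ n = b ^ n * c) → ∃ d, a = b * d

namespace Hochster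

open RingTheory.Sequence

/-- Weakly regular sequences in the maximal ideal suffice. -/
lemma cmLocal_of_weaklyRegular {A : Type*} [CommRing A] [IsLocalRing A]
    (rs : List A) (h : ∀ x ∈ rs, x ∈ IsLocalRing.maximalIdeal A) (hreg : IsWeaklyRegular A rs)
    (hlen : (rs.length : WithBot (WithTop ℕ)) = ringKrullDim A) : IsCohenMacaulayLocalRing A :=
  ⟨rs, h, (IsLocalRing.isRegular_iff_isWeaklyRegular_of_subset_maximalIdeal h).2 hreg, hlen⟩

lemma cmLocal_of_ringEquiv {A B : Type*} [CommRing A] [IsLocalRing A] [CommRing B] [IsLocalRing B]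
    (e : A ≃+* B) (h : IsCohenMacaulayLocalRing A) : IsCohenMacaulayLocalRing B := by
  obtain ⟨rs, h1, h2, h3⟩ := h
  let := e.toRingHom.toAlgebra
  have hfl : Module.Flat A B := by
    have : Function.Bijective (algebraMap A B) := e.bijective
    exact Module.Flat.of_linearEquiv (LinearEquiv.ofBijective (Algebra.linearMap A B) this).symm
  refine cmLocal_of_weaklyRegular (rs.map (algebraMap A B)) ?_ h2.toIsWeaklyRegular.of_flat ?_
  · intro x hx
    obtain ⟨y, hy, rfl⟩ := List.mem_map.1 hx
    have := h1 y hy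
    rw [IsLocalRing.mem_maximalIdeal, mem_nonunits_iff] at this ⊢
    intro h
    exact this ((MulEquiv.isUnit_map e).1 h)
  · rw [List.length_map, h3]
    exact ringKrullDim_eq_of_ringEquiv e

lemma cm_of_ringEquiv {A B : Type*} [CommRing A] [CommRing B]
    (e : A ≃+* B) (h : IsCohenMacaulayRing A) : IsCohenMacaulayRing B := by
  intro q hq
  have := h (q.comap e.toRingHom) inferInstance
  refine cmLocal_of_ringEquiv ?_ this
  refine IsLocalization.ringEquivOfRingEquiv (M := (q.comap e.toRingHom).primeCompl)
    (T := q.primeCompl) (Localization.AtPrime _) (Localization.AtPrime q) e ?_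
  ext x
  simp only [Submonoid.mem_map, Ideal.primeCompl, Submonoid.mem_mk]
  constructor
  · rintro ⟨y, hy, rfl⟩; exact hy
  · intro hx
    refine ⟨e.symm x, ?_, by simp⟩
    change ¬ (e (e.symm x) ∈ q)
    simpa using hx

lemma height_eq_of_flat_integral {S A : Type*} [CommRing S] [CommRing A] [Algebra S A]
    [IsNoetherianRing S] [IsNoetherianRing A] [Module.Flat S A] [Algebra.IsIntegral S A]
    (q : Ideal A) [q.IsPrime] : q.height = (q.under S).height := by
  rw [Ideal.height_eq_height_add_of_liesOver_of_hasGoingDown (q.under S) q]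
  suffices h : (q.map (Ideal.Quotient.mk <| (q.under S).map (algebraMap S A))).height = 0 by
    rw [h, add_zero]
  have hle : (q.under S).map (algebraMap S A) ≤ q := Ideal.map_comap_le
  have hpr : (q.map (Ideal.Quotient.mk <| (q.under S).map (algebraMap S A))).IsPrime :=
    Ideal.map_isPrime_of_surjective Ideal.Quotient.mk_surjective (by simpa using hle)
  rw [Ideal.height_eq_zero_iff]
  refine ⟨⟨hpr, bot_le⟩, ?_⟩
  rintro J ⟨hJ, -⟩ hJle
  have h1 : J.comap (Ideal.Quotient.mk _) ≤ q := by
    refine (Ideal.comap_mono hJle).trans ?_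
    rw [Ideal.comap_map_of_surjective _ Ideal.Quotient.mk_surjective]
    refine sup_le le_rfl ?_
    rw [← RingHom.ker_eq_comap_bot, Ideal.mk_ker]
    exact hle
  have h2 : J.comap (Ideal.Quotient.mk ((q.under S).map (algebraMap S A))) = q := by
    have hJ' : (J.comap (Ideal.Quotient.mk ((q.under S).map (algebraMap S A)))).IsPrime :=
      inferInstance
    by_contra hne
    have hlt := lt_of_le_of_ne h1 hne
    have := Ideal.IsIntegral.comap_lt_comap (R := S) hlt
    refine absurd this (not_lt_of_ge ?_)
    have h3 : (q.under S).map (algebraMap S A) ≤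
        J.comap (Ideal.Quotient.mk ((q.under S).map (algebraMap S A))) := by
      intro x hx
      rw [Ideal.mem_comap, Ideal.Quotient.eq_zero_iff_mem.2 hx]
      exact J.zero_mem
    exact Ideal.map_le_iff_le_comap.1 h3
  exact Ideal.map_le_iff_le_comap.2 h2.ge

lemma cm_of_flat_integral {S A : Type*} [CommRing S] [CommRing A] [Algebra S A]
    [IsNoetherianRing S] [IsNoetherianRing A] [Module.Flat S A] [Algebra.IsIntegral S A]
    (hS : IsCohenMacaulayRing S) : IsCohenMacaulayRing A := by
  intro q hq
  obtain ⟨rs, h1, h2, h3⟩ := hS (q.under S) inferInstance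
  let f := Localization.localRingHom (q.under S) q (algebraMap S A) rfl
  have hf : f.Flat := RingHom.Flat.localRingHom (RingHom.flat_algebraMap_iff.2 inferInstance) _ _ _
  let := f.toAlgebra
  have : Module.Flat (Localization.AtPrime (q.under S)) (Localization.AtPrime q) := hf
  have hloc : IsLocalHom f := Localization.isLocalHom_localRingHom _ _ _ rfl
  refine cmLocal_of_weaklyRegular (rs.map (algebraMap _ _)) ?_ h2.toIsWeaklyRegular.of_flat ?_
  · intro x hx
    obtain ⟨y, hy, rfl⟩ := List.mem_map.1 hx
    have := h1 y hy
    rw [IsLocalRing.mem_maximalIdeal, mem_nonunits_iff] at this ⊢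
    intro h
    exact this (hloc.map_nonunit _ h)
  · rw [List.length_map, h3, IsLocalization.AtPrime.ringKrullDim_eq_height (q.under S),
      IsLocalization.AtPrime.ringKrullDim_eq_height q, height_eq_of_flat_integral (S := S) q]

open Polynomial IsLocalRing in
lemma cmLocal_polynomial {R : Type*} [CommRing R] [IsNoetherianRing R] [IsLocalRing R]
    (hR : IsCohenMacaulayLocalRing R) (p : Ideal R[X]) [p.IsPrime]
    (max : p.comap C = maximalIdeal R) : IsCohenMacaulayLocalRing (Localization.AtPrime p) := by
  obtain ⟨rs, h1, h2, h3⟩ := hR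
  let q := (maximalIdeal R).map C
  have qle : q ≤ p := by simpa [q, ← max] using Ideal.map_comap_le
  have hqpr : q.IsPrime := Ideal.isPrime_map_C_of_isPrime
  have htq : q.height = (maximalIdeal R).height := height_map_C (maximalIdeal R)
  have hmem : ∀ x ∈ rs.map C, x ∈ p := by
    intro x hx
    obtain ⟨y, hy, rfl⟩ := List.mem_map.1 hx
    exact qle (Ideal.mem_map_of_mem _ (h1 y hy))
  have hwr : IsWeaklyRegular R[X] (rs.map C) := h2.toIsWeaklyRegular.of_flat
  have hlen : ((rs.length : ℕ∞) : WithBot ℕ∞) = ((maximalIdeal R).height : WithBot ℕ∞) := by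
    rw [maximalIdeal_height_eq_ringKrullDim]; exact h3
  have hlen' : (rs.length : ℕ∞) = (maximalIdeal R).height := WithBot.coe_injective hlen
  have key : ∀ l : List R[X], (∀ x ∈ l, x ∈ p) → IsWeaklyRegular R[X] l → 
      (l.length : ℕ∞) = p.height → IsCohenMacaulayLocalRing (Localization.AtPrime p) := by
    intro l hl hw hlen
    refine cmLocal_of_weaklyRegular (l.map (algebraMap _ _)) ?_
      (hw.of_isLocalization (Localization.AtPrime p) p.primeCompl) ?_
    · intro x hx
      obtain ⟨y, hy, rfl⟩ := List.mem_map.1 hx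
      exact (IsLocalization.AtPrime.to_map_mem_maximal_iff _ p y).2 (hl y hy)
    · rw [IsLocalization.AtPrime.ringKrullDim_eq_height p, ← hlen, List.length_map]
      rfl
  by_cases eq : p = q
  · exact key _ hmem hwr (by rw [List.length_map, hlen', eq, htq])
  · have lt : q < p := lt_of_le_of_ne qle (Ne.symm eq)
    have : (p.comap C).IsMaximal := by simpa [max] using maximalIdeal.isMaximal R
    obtain ⟨y, hym, hy⟩ := Polynomial.exists_monic_span_sup_map_eq R p this (by simpa [max])
    have hyp : y ∈ p := by
      rw [hy]; exact Ideal.mem_sup_right (Ideal.mem_span_singleton_self y)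
    refine key (rs.map C ++ [y]) ?_ ?_ ?_
    · intro x hx
      rcases List.mem_append.1 hx with h | h
      · exact hmem x h
      · simp at h; exact h ▸ hyp
    · rw [isWeaklyRegular_append_iff, isWeaklyRegular_singleton_iff]
      refine ⟨hwr, ?_⟩
      rw [isSMulRegular_iff_right_eq_zero_of_smul]
      intro x
      induction x using Submodule.Quotient.induction_on with | _ g => ?_
      rw [← Submodule.Quotient.mk_smul, Submodule.Quotient.mk_eq_zero, Submodule.Quotient.mk_eq_zero]
      have hI : (Ideal.ofList (rs.map (C : R →+* R[X])) • ⊤ : Submodule R[X] R[X]) =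
          (Ideal.ofList rs).map C := by
        rw [Ideal.map_ofList]; simp
      rw [hI, smul_eq_mul, ← Ideal.mk_ker (I := Ideal.ofList rs), ← Polynomial.ker_mapRingHom,
        RingHom.mem_ker, RingHom.mem_ker, map_mul]
      intro h
      exact (Monic.isRegular (hym.map (Ideal.Quotient.mk (Ideal.ofList rs)))).left
        (by simpa using h)
    · have hlo : p.LiesOver (maximalIdeal R) := ⟨max.symm⟩
      rw [List.length_append, List.length_map, List.length_singleton, Nat.cast_add, hlen']
      refine le_antisymm ?_ ?_
      · rw [← htq]; exact_mod_cast Ideal.height_add_one_le_of_lt_of_isPrime lt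
      · refine (Ideal.height_le_height_add_of_liesOver (maximalIdeal R) p).trans ?_
        refine add_le_add le_rfl ?_
        have : p.map (Ideal.Quotient.mk ((maximalIdeal R).map (algebraMap R R[X]))) =
            Ideal.span {Ideal.Quotient.mk _ y} := by
          conv_lhs => rw [hy]
          rw [Ideal.map_sup, Ideal.map_span, Set.image_singleton, max, algebraMap_eq,
            Ideal.map_quotient_self, bot_sup_eq]
        rw [this]
        refine (Ideal.height_span_singleton_le_one ?_).trans (by simp)
        intro hu
        have hpr : (p.map (Ideal.Quotient.mk ((maximalIdeal R).map (algebraMap R R[X])))).IsPrime :=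
          Ideal.map_isPrime_of_surjective Ideal.Quotient.mk_surjective (by simpa using! qle)
        exact hpr.ne_top (this.trans (Ideal.span_singleton_eq_top.2 hu))

open Polynomial IsLocalRing in
lemma cm_polynomial {R : Type*} [CommRing R] [IsNoetherianRing R]
    (hR : IsCohenMacaulayRing R) : IsCohenMacaulayRing R[X] := by
  intro p hp
  let q := p.comap C
  let S := (Localization.AtPrime q)[X]
  let pc := Submonoid.map Polynomial.C.toMonoidHom q.primeCompl
  let : Algebra R[X] S := algebra R (Localization.AtPrime q)
  have : IsLocalization pc S := Polynomial.isLocalization _ _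
  let pS := p.map (algebraMap R[X] S)
  have disj : Disjoint (pc : Set R[X]) (p : Set R[X]) := by
    simpa [pc, q] using! Set.disjoint_image_left.mpr
      (Set.disjoint_compl_left_iff_subset.mpr (fun _ a ↦ a))
  have : pS.IsPrime := IsLocalization.isPrime_of_isPrime_disjoint pc _ _ ‹_› disj
  have : IsLocalization.AtPrime (Localization.AtPrime pS) p := by
    convert IsLocalization.isLocalization_isLocalization_atPrime_isLocalization pc
      (Localization.AtPrime pS) pS
    exact (IsLocalization.under_map_of_isPrime_disjoint pc _ ‹_› disj).symm
  have eq : Ideal.comap C pS = maximalIdeal (Localization.AtPrime q) := by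
    rw [← IsLocalization.map_under q.primeCompl _ (Ideal.comap C pS),
      ← IsLocalization.map_under q.primeCompl _ (maximalIdeal (Localization.AtPrime q))]
    simp only [Ideal.comap_comap, S, pS]
    rw [← Polynomial.algebraMap_eq (R := Localization.AtPrime q),
      ← IsScalarTower.algebraMap_eq R (Localization.AtPrime q) (Localization.AtPrime q)[X],
      IsScalarTower.algebraMap_eq R R[X] (Localization.AtPrime q)[X], ← Ideal.comap_comap,
      ← Ideal.under_def R[X], IsLocalization.under_map_of_isPrime_disjoint pc _ ‹_› disj]
    simp [q, IsLocalization.AtPrime.under_maximalIdeal (Localization.AtPrime q) q]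
  have := cmLocal_polynomial (hR q inferInstance) pS eq
  exact cmLocal_of_ringEquiv (IsLocalization.algEquiv p.primeCompl
    (Localization.AtPrime pS) (Localization.AtPrime p)).toRingEquiv this

lemma cm_mvPolynomial {R : Type*} [CommRing R] [IsNoetherianRing R]
    (hR : IsCohenMacaulayRing R) (n : ℕ) : IsCohenMacaulayRing (MvPolynomial (Fin n) R) := by
  induction n with
  | zero => exact cm_of_ringEquiv (MvPolynomial.isEmptyRingEquiv R _).symm hR
  | succ n ih =>
    exact cm_of_ringEquiv (MvPolynomial.finSuccEquiv R n).toRingEquiv.symm (cm_polynomial ih)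

end Hochster

namespace Hochster

/-- Membership in the cone spanned by a list of vectors. -/
def InCone {V : Type*} [AddCommGroup V] [Module ℚ V] : List V → V → Prop
  | [], x => x = 0
  | v :: vs, x => ∃ t : ℚ, 0 ≤ t ∧ InCone vs (x - t • v)

/-- Fourier–Motzkin: a finitely generated cone is cut out by finitely many linear forms. -/
lemma fourier_motzkin {V : Type*} [AddCommGroup V] [Module ℚ V] [FiniteDimensional ℚ V]
    (vs : List V) : ∃ ls : Finset (Module.Dual ℚ V), ∀ x, InCone vs x ↔ ∀ l ∈ ls, 0 ≤ l x := by
  classical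
  induction vs with
  | nil =>
    let b := Module.finBasis ℚ V
    refine ⟨Finset.univ.image (fun i => b.coord i) ∪ Finset.univ.image (fun i => - b.coord i), ?_⟩
    intro x
    simp only [InCone]
    constructor
    · rintro rfl l -; simp
    · intro h
      refine b.ext_elem fun i => ?_
      have h1 := h (b.coord i) (by simp)
      have h2 := h (- b.coord i) (by simp)
      simp at h1 h2 ⊢
      linarith
  | cons v vs ih =>
    obtain ⟨ls, hls⟩ := ih
    let P := ls.filter (fun l => 0 ≤ l v)
    let Pp := ls.filter (fun l => 0 < l v)
    let Ng := ls.filter (fun l => l v < 0)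
    refine ⟨P ∪ (Pp ×ˢ Ng).image (fun z => (z.1 v) • z.2 - (z.2 v) • z.1), ?_⟩
    intro x
    simp only [InCone, hls]
    constructor
    · rintro ⟨t, ht, h⟩ l hl
      rcases Finset.mem_union.1 hl with hl | hl
      · obtain ⟨h1, h2⟩ := Finset.mem_filter.1 hl
        have := h l h1
        simp at this
        nlinarith
      · obtain ⟨⟨j, k⟩, hz, rfl⟩ := Finset.mem_image.1 hl
        obtain ⟨hj, hk⟩ := Finset.mem_product.1 hz
        obtain ⟨hj1, hj2⟩ := Finset.mem_filter.1 hj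
        obtain ⟨hk1, hk2⟩ := Finset.mem_filter.1 hk
        have e1 := h j hj1
        have e2 := h k hk1
        simp at e1 e2 hj2 hk2 ⊢
        nlinarith
    · intro h
      have hP : ∀ l ∈ ls, 0 ≤ l v → 0 ≤ l x := fun l hl h0 =>
        h l (Finset.mem_union_left _ (Finset.mem_filter.2 ⟨hl, h0⟩))
      have hPN : ∀ j ∈ ls, ∀ k ∈ ls, 0 < j v → k v < 0 → 0 ≤ j v * k x - k v * j x := by
        intro j hj k hk h1 h2
        have := h ((j v) • k - (k v) • j) (Finset.mem_union_right _ (Finset.mem_image.2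
          ⟨(j, k), Finset.mem_product.2 ⟨Finset.mem_filter.2 ⟨hj, h1⟩,
            Finset.mem_filter.2 ⟨hk, h2⟩⟩, rfl⟩))
        simpa using this
      -- the lower bounds for `t`
      let L : Finset ℚ := insert 0 (Ng.image (fun k => k x / k v))
      have hL : L.Nonempty := ⟨0, Finset.mem_insert_self _ _⟩
      refine ⟨L.max' hL, L.le_max' 0 (Finset.mem_insert_self _ _), ?_⟩
      intro l hl
      simp only [map_sub, map_smul, smul_eq_mul, sub_nonneg]
      rcases lt_trichotomy (l v) 0 with h0 | h0 | h0
      · have : l x / l v ≤ L.max' hL := L.le_max' _ (Finset.mem_insert_of_mem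
          (Finset.mem_image.2 ⟨l, Finset.mem_filter.2 ⟨hl, h0⟩, rfl⟩))
        rwa [div_le_iff_of_neg h0] at this
      · rw [h0, mul_zero]; exact hP l hl h0.ge
      · rw [← le_div_iff₀ h0]
        refine Finset.max'_le _ _ _ ?_
        intro y hy
        rcases Finset.mem_insert.1 hy with rfl | hy
        · exact div_nonneg (hP l hl h0.le) h0.le
        · obtain ⟨k, hk, rfl⟩ := Finset.mem_image.1 hy
          obtain ⟨hk1, hk2⟩ := Finset.mem_filter.1 hk
          have := hPN l hl k hk1 h0 hk2
          rw [le_div_iff₀ h0, div_mul_eq_mul_div, div_le_iff_of_neg hk2]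
          linarith

lemma inCone_mem {V : Type*} [AddCommGroup V] [Module ℚ V] (vs : List V) {v : V} (hv : v ∈ vs) :
    InCone vs v := by
  have h0 : ∀ vs : List V, InCone vs 0 := by
    intro vs
    induction vs with
    | nil => rfl
    | cons w vs ih => exact ⟨0, le_rfl, by simpa using ih⟩
  induction vs with
  | nil => simp at hv
  | cons w vs ih =>
    rcases List.mem_cons.1 hv with rfl | hv
    · exact ⟨1, zero_le_one, by simpa using h0 vs⟩
    · exact ⟨0, le_rfl, by simpa using ih hv⟩

lemma inCone_clear {V : Type*} [AddCommGroup V] [Module ℚ V] (S : AddSubmonoid V) (vs : List V)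
    (hvs : ∀ v ∈ vs, v ∈ S) (x : V) (h : InCone vs x) : ∃ n : ℕ, 0 < n ∧ n • x ∈ S := by
  induction vs generalizing x with
  | nil => exact ⟨1, one_pos, by rw [show x = 0 from h]; simp⟩
  | cons v vs ih =>
    obtain ⟨t, ht, h⟩ := h
    obtain ⟨n, hn, hx⟩ := ih (fun w hw => hvs w (List.mem_cons_of_mem _ hw)) _ h
    refine ⟨t.den * n, Nat.mul_pos t.den_pos hn, ?_⟩
    have hv := hvs v List.mem_cons_self
    have : (t.den * n) • x = t.den • (n • (x - t • v)) + (n * t.num.toNat) • v := by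
      have h1 : ((t.num.toNat : ℕ) : ℚ) = t.den * t := by
        rw [mul_comm, Rat.mul_den_eq_num, ← Int.cast_natCast (R := ℚ),
          Int.toNat_of_nonneg (Rat.num_nonneg.2 ht)]
      simp only [← Nat.cast_smul_eq_nsmul ℚ]
      push_cast
      rw [h1]
      module
    rw [this]
    exact S.add_mem (S.nsmul_mem hx _) (S.nsmul_mem hv _)

section
variable {A : Type*} [AddCancelCommMonoid A]

lemma exists_embedding_rat (hfg : AddMonoid.FG A) (hsharp : ∀ x y : A, x + y = 0 → x = 0)
    (hsat : ∀ a b : A, ∀ n : ℕ, 0 < n → (∃ c, n • a = n • b + c) → ∃ d, a = b + d) :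
    ∃ (r : ℕ) (f : A →+ (Fin r → ℚ)), Function.Injective f := by
  classical
  let G := Algebra.GrothendieckAddGroup A
  let ι : A →+ G := Algebra.GrothendieckAddGroup.of
  have hι : Function.Injective ι := Algebra.GrothendieckAddGroup.of_injective
  have hG : ∀ g : G, ∃ a b : A, g + ι b = ι a := by
    intro g
    obtain ⟨⟨a, b⟩, h⟩ := (AddLocalization.addMonoidOf (⊤ : AddSubmonoid A)).surj g
    exact ⟨a, b, h⟩
  have htf : ∀ (n : ℕ) (g : G), n ≠ 0 → n • g = 0 → g = 0 := by
    intro n g hn hg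
    obtain ⟨a, b, h⟩ := hG g
    have h1 : n • b = n • a := by
      apply hι
      rw [map_nsmul, map_nsmul, ← h, nsmul_add, hg, zero_add]
    obtain ⟨d, hd⟩ := hsat a b n (Nat.pos_of_ne_zero hn) ⟨0, by rw [h1, add_zero]⟩
    obtain ⟨d', hd'⟩ := hsat b a n (Nat.pos_of_ne_zero hn) ⟨0, by rw [h1, add_zero]⟩
    have : d + d' = 0 := by
      have h2 : b + (d + d') = b + 0 := by
        rw [← add_assoc, ← hd, ← hd', add_zero]
      exact add_left_cancel h2
    rw [hsharp d d' this, add_zero] at hd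
    rw [hd] at h
    simpa using h
  have hfin : Module.Finite ℤ G := by
    obtain ⟨S, hS⟩ := hfg.fg_top
    refine ⟨⟨S.image ι, ?_⟩⟩
    rw [eq_top_iff]
    rintro g -
    have hmem : ∀ a : A, ι a ∈ Submodule.span ℤ ((S.image ι : Finset G) : Set G) := by
      intro a
      have ha : a ∈ AddSubmonoid.closure (S : Set A) := hS ▸ AddSubmonoid.mem_top a
      induction ha using AddSubmonoid.closure_induction with
      | mem x hx => exact Submodule.subset_span (by simpa using ⟨x, hx, rfl⟩)
      | zero => simp
      | add x y _ _ hx hy => rw [map_add]; exact Submodule.add_mem _ hx hy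
    obtain ⟨a, b, h⟩ := hG g
    rw [eq_sub_of_add_eq h]
    exact Submodule.sub_mem _ (hmem a) (hmem b)
  have htf' : Module.IsTorsionFree ℤ G := by
    refine Module.IsTorsionFree.of_smul_eq_zero fun n g hng => ?_
    by_cases hn : n = 0
    · exact Or.inl hn
    · right
      refine htf n.natAbs g (by simpa using hn) ?_
      rcases Int.natAbs_eq n with h | h
      · rw [← natCast_zsmul, ← h]; exact hng
      · rw [← natCast_zsmul, ← neg_eq_zero, ← neg_zsmul, ← h]; exact hng
  let b := Module.finBasis ℤ G
  let e : G →+ (Fin (Module.finrank ℤ G) → ℚ) :=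
    { toFun := fun g i => ((b.repr g i : ℤ) : ℚ)
      map_zero' := by ext; simp
      map_add' := by intros; ext; simp }
  refine ⟨_, e.comp ι, ?_⟩
  have he : Function.Injective e := by
    intro x y hxy
    apply b.ext_elem
    intro i
    have : ((b.repr x i : ℤ) : ℚ) = ((b.repr y i : ℤ) : ℚ) := congrFun hxy i
    exact_mod_cast this
  exact he.comp hι

lemma exists_nat_hom (hfg : AddMonoid.FG A) (f : A →+ ℚ) (hf : ∀ a, 0 ≤ f a) :
    ∃ g : A →+ ℕ, ∀ a b, g a ≤ g b → f a ≤ f b := by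
  have h1 : ∃ k : ℕ, 0 < k ∧ ∀ a, ∃ m : ℕ, (m : ℚ) = k * f a := by
    obtain ⟨S, hS⟩ := hfg.fg_top
    refine ⟨∏ s ∈ S, (f s).den, Finset.prod_pos fun s _ => (f s).den_pos, ?_⟩
    intro a
    have ha : a ∈ AddSubmonoid.closure (S : Set A) := hS ▸ AddSubmonoid.mem_top a
    induction ha using AddSubmonoid.closure_induction with
    | mem x hx =>
      obtain ⟨c, hc⟩ := Finset.dvd_prod_of_mem (fun s => (f s).den) hx
      refine ⟨c * (f x).num.toNat, ?_⟩
      rw [hc]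
      have h1 : (((f x).num.toNat : ℕ) : ℚ) = (f x).den * f x := by
        rw [mul_comm, Rat.mul_den_eq_num, ← Int.cast_natCast (R := ℚ),
          Int.toNat_of_nonneg (Rat.num_nonneg.2 (hf x))]
      push_cast
      rw [h1]; ring
    | zero => exact ⟨0, by simp⟩
    | add x y _ _ hx hy =>
      obtain ⟨m, hm⟩ := hx
      obtain ⟨n, hn⟩ := hy
      exact ⟨m + n, by rw [Nat.cast_add, map_add, hm, hn]; ring⟩
  obtain ⟨k, hk, h⟩ := h1
  choose g hg using h
  refine ⟨{ toFun := g, map_zero' := ?_, map_add' := ?_ }, ?_⟩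
  · have := hg 0; simpa using this
  · intro x y
    have : ((g (x + y) : ℕ) : ℚ) = ((g x + g y : ℕ) : ℚ) := by
      push_cast; rw [hg, hg, hg, map_add]; ring
    exact_mod_cast this
  · intro a b hab
    have h2 : g a ≤ g b := hab
    have : ((g a : ℕ) : ℚ) ≤ (g b : ℕ) := by exact_mod_cast h2
    rw [hg, hg] at this
    exact le_of_mul_le_mul_left this (by exact_mod_cast hk)

lemma exists_full_embedding (hfg : AddMonoid.FG A) (hsharp : ∀ x y : A, x + y = 0 → x = 0)
    (hsat : ∀ a b : A, ∀ n : ℕ, 0 < n → (∃ c, n • a = n • b + c) → ∃ d, a = b + d) :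
    ∃ (s : ℕ) (N : AddSubmonoid (Fin s → ℕ)), (∀ a ∈ N, ∀ b ∈ N, b ≤ a → a - b ∈ N) ∧
      Nonempty (A ≃+ N) := by
  classical
  obtain ⟨r, f, hf⟩ := exists_embedding_rat hfg hsharp hsat
  obtain ⟨S, hS⟩ := hfg.fg_top
  obtain ⟨ls, hls⟩ := fourier_motzkin (S.toList.map f)
  have hmem : ∀ a : A, ∀ l ∈ ls, 0 ≤ l (f a) := by
    intro a l hl
    have ha : a ∈ AddSubmonoid.closure (S : Set A) := hS ▸ AddSubmonoid.mem_top a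
    induction ha using AddSubmonoid.closure_induction with
    | mem x hx =>
      exact (hls (f x)).1 (inCone_mem _ (List.mem_map.2 ⟨x, by simpa using hx, rfl⟩)) l hl
    | zero => simp
    | add x y _ _ hx hy => rw [map_add, map_add]; exact add_nonneg hx hy
  have hg : ∀ l : ls, ∃ g : A →+ ℕ, ∀ a b, g a ≤ g b → l.1 (f a) ≤ l.1 (f b) := fun l =>
    exists_nat_hom hfg (l.1.toAddMonoidHom.comp f) (fun a => hmem a l.1 l.2)
  choose g hg using hg
  let e := ls.equivFin
  let F : A →+ (Fin ls.card → ℕ) :=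
    { toFun := fun a i => g (e.symm i) a
      map_zero' := by ext; simp
      map_add' := by intros; ext; simp }
  have key : ∀ a b : A, F b ≤ F a → ∃ d, a = b + d := by
    intro a b hab
    have h1 : InCone (S.toList.map f) (f a - f b) := by
      rw [hls]
      intro l hl
      rw [map_sub, sub_nonneg]
      refine hg ⟨l, hl⟩ b a ?_
      have := hab (e ⟨l, hl⟩)
      simpa [F] using this
    obtain ⟨n, hn, c, hc⟩ := inCone_clear (AddMonoidHom.mrange f) _ (by
      intro v hv
      obtain ⟨x, -, rfl⟩ := List.mem_map.1 hv
      exact ⟨x, rfl⟩) _ h1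
    refine hsat a b n hn ⟨c, hf ?_⟩
    rw [map_add, map_nsmul, map_nsmul, hc, nsmul_sub]
    abel
  have hinj : Function.Injective F := by
    intro a b hab
    obtain ⟨d, hd⟩ := key a b hab.ge
    obtain ⟨d', hd'⟩ := key b a hab.le
    have : d + d' = 0 := by
      have h2 : b + (d + d') = b + 0 := by
        rw [← add_assoc, ← hd, ← hd', add_zero]
      exact add_left_cancel h2
    rw [hd, hsharp d d' this, add_zero]
  refine ⟨ls.card, AddMonoidHom.mrange F, ?_, ⟨AddEquiv.ofBijective F.mrangeRestrict
    ⟨fun a b h => hinj (congrArg Subtype.val h), F.mrangeRestrict_surjective⟩⟩⟩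
  rintro _ ⟨a, rfl⟩ _ ⟨b, rfl⟩ hab
  obtain ⟨d, rfl⟩ := key a b hab
  exact ⟨d, by rw [map_add, add_tsub_cancel_left]⟩

end

end Hochster
namespace Hochster

/-- degree -/
def dg {s : ℕ} (m : Fin s → ℕ) : ℕ := ∑ j, m j

/-- support -/
def spp {s : ℕ} (m : Fin s → ℕ) : Finset (Fin s) := Finset.univ.filter (fun i => m i ≠ 0)

/-- rational cast -/
def qc {s : ℕ} (m : Fin s → ℕ) : Fin s → ℚ := fun i => (m i : ℚ)

/-- span of the elements supported on T -/
noncomputable def VT {s : ℕ} (N : AddSubmonoid (Fin s → ℕ)) (T : Finset (Fin s)) : Submodule ℚ (Fin s → ℚ) :=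
  Submodule.span ℚ (qc '' {m | m ∈ N ∧ spp m ⊆ T})

/-- rank -/
noncomputable def rk {s : ℕ} (N : AddSubmonoid (Fin s → ℕ)) : ℕ := Module.finrank ℚ (VT N Finset.univ)

lemma mem_spp {s : ℕ} (m : Fin s → ℕ) (i : Fin s) : i ∈ spp m ↔ m i ≠ 0 := by simp [spp]

lemma VT_mono {s : ℕ} (N : AddSubmonoid (Fin s → ℕ)) {T T' : Finset (Fin s)} (h : T ⊆ T') :
    VT N T ≤ VT N T' := by
  apply Submodule.span_mono
  apply Set.image_mono
  rintro m ⟨h1, h2⟩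
  exact ⟨h1, h2.trans h⟩

lemma VT_zero {s : ℕ} (N : AddSubmonoid (Fin s → ℕ)) {T : Finset (Fin s)} {i : Fin s} (hi : i ∉ T)
    {v : Fin s → ℚ} (hv : v ∈ VT N T) : v i = 0 := by
  induction hv using Submodule.span_induction with
  | mem x hx =>
    obtain ⟨m, ⟨_, h2⟩, rfl⟩ := hx
    by_contra h
    apply hi
    apply h2
    rw [mem_spp]
    intro h0
    simp [qc, h0] at h
  | zero => rfl
  | add x y _ _ hx hy => simp [hx, hy]
  | smul a x _ hx => simp [hx]

lemma rk_strict {s : ℕ} (N : AddSubmonoid (Fin s → ℕ)) {T T' : Finset (Fin s)} (h : T ⊂ T')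
    {m : Fin s → ℕ} (hm : m ∈ N) (hT : spp m = T') :
    Module.finrank ℚ (VT N T) < Module.finrank ℚ (VT N T') := by
  apply Submodule.finrank_lt_finrank_of_lt
  refine lt_of_le_of_ne (VT_mono N h.1) ?_
  intro he
  obtain ⟨i, hi, hi'⟩ := Finset.exists_of_ssubset h
  have : qc m ∈ VT N T := by
    rw [he]
    exact Submodule.subset_span ⟨m, ⟨hm, hT.le⟩, rfl⟩
  have h2 := VT_zero N hi' this
  rw [← hT, mem_spp] at hi
  apply hi
  simpa [qc] using h2

lemma dg_pos {s : ℕ} {m : Fin s → ℕ} (h : (spp m).Nonempty) : 0 < dg m := by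
  obtain ⟨i, hi⟩ := h
  rw [mem_spp] at hi
  exact lt_of_lt_of_le (Nat.pos_of_ne_zero hi) (Finset.single_le_sum (f := m) (fun _ _ => Nat.zero_le _) (Finset.mem_univ i))

lemma dg_smul {s : ℕ} (n : ℕ) (m : Fin s → ℕ) : dg (n • m) = n * dg m := by
  simp [dg, Finset.mul_sum]

lemma dg_add {s : ℕ} (n : Fin s → ℕ) (m : Fin s → ℕ) : dg (n + m) = dg n + dg m := by
  simp [dg, Finset.sum_add_distrib]

lemma spp_smul {s : ℕ} {n : ℕ} (hn : 0 < n) (m : Fin s → ℕ) : spp (n • m) = spp m := by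
  ext i; simp [mem_spp]; omega

lemma exists_mu {s : ℕ} (N : AddSubmonoid (Fin s → ℕ)) :
    ∃ D > 0, ∃ μ : Finset (Fin s) → N, ∀ T, T.Nonempty → (∃ m ∈ N, spp m = T) →
      spp (μ T : Fin s → ℕ) = T ∧ dg (μ T : Fin s → ℕ) = D := by
  classical
  have h : ∀ T : Finset (Fin s), ∃ m : N, T.Nonempty → (∃ m ∈ N, spp m = T) → spp (m : Fin s → ℕ) = T := by
    intro T
    by_cases h : ∃ m ∈ N, spp m = T
    · obtain ⟨m, hm, hT⟩ := h
      exact ⟨⟨m, hm⟩, fun _ _ => hT⟩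
    · exact ⟨0, fun _ h' => (h h').elim⟩
  choose m hm using h
  let f : Finset (Fin s) → ℕ := fun T => max 1 (dg (m T : Fin s → ℕ))
  refine ⟨∏ T, f T, Finset.prod_pos (fun T _ => by simp [f]), fun T => ((∏ T, f T) / f T) • m T, ?_⟩
  intro T hT hT'
  have h1 := hm T hT hT'
  have h2 : 0 < dg (m T : Fin s → ℕ) := dg_pos (by rw [h1]; exact hT)
  have h3 : f T = dg (m T : Fin s → ℕ) := by simp only [f]; omega
  have h4 : f T ∣ ∏ T, f T := Finset.dvd_prod_of_mem f (Finset.mem_univ T)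
  have h5 : 0 < ∏ T, f T := Finset.prod_pos (fun T _ => by simp [f])
  have h6 : 0 < (∏ T, f T) / f T := Nat.div_pos (Nat.le_of_dvd h5 h4) (by omega)
  constructor
  · rw [AddSubmonoidClass.coe_nsmul, spp_smul h6, h1]
  · rw [AddSubmonoidClass.coe_nsmul, dg_smul, ← h3, Nat.div_mul_cancel h4]

lemma exists_theta {s : ℕ} (N : AddSubmonoid (Fin s → ℕ))
    (hfull : ∀ a ∈ N, ∀ b ∈ N, b ≤ a → a - b ∈ N) :
    ∃ D > 0, ∃ Θ : Fin (rk N) → Finset N, (∀ i, ∀ m ∈ Θ i, dg (m : Fin s → ℕ) = D) ∧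
      ∀ F : Set N, (∀ a b, a + b ∈ F ↔ a ∈ F ∧ b ∈ F) → (∃ a ∈ F, a ≠ 0) →
        ∃ i, ∃ m ∈ Θ i, m ∈ F ∧ ∀ m' ∈ Θ i, m' ∈ F → m' = m := by
  classical
  obtain ⟨D, hD, μ, hμ⟩ := exists_mu N
  let P : Finset (Fin s) → Prop := fun T => T.Nonempty ∧ ∃ m ∈ N, spp m = T
  let ρ : Finset (Fin s) → ℕ := fun T => Module.finrank ℚ (VT N T)
  refine ⟨D, hD, fun i => (Finset.univ.filter (fun T => P T ∧ ρ T = i + 1)).image μ, ?_, ?_⟩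
  · intro i m hm
    simp only [Finset.mem_image, Finset.mem_filter, Finset.mem_univ, true_and] at hm
    obtain ⟨T, ⟨⟨h1, h2⟩, _⟩, rfl⟩ := hm
    exact (hμ T h1 h2).2
  · rintro F hF ⟨a, haF, ha0⟩
    obtain ⟨m, hmF, hmax⟩ : ∃ m ∈ F, ∀ m' ∈ F, (spp (m' : Fin s → ℕ)).card ≤ (spp (m : Fin s → ℕ)).card := by
      have hfin : ((fun m : N => (spp (m : Fin s → ℕ)).card) '' F).Finite := by
        apply Set.Finite.subset (Set.finite_Iic s)
        rintro _ ⟨m, _, rfl⟩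
        simpa using Finset.card_le_univ (spp (m : Fin s → ℕ))
      obtain ⟨m, hm, hmm⟩ := Set.exists_max_image _ id hfin ⟨_, a, haF, rfl⟩
      obtain ⟨m, hm, rfl⟩ := hm
      exact ⟨m, hm, fun m' hm' => hmm _ ⟨m', hm', rfl⟩⟩
    have hsub : ∀ m' ∈ F, spp (m' : Fin s → ℕ) ⊆ spp (m : Fin s → ℕ) := by
      intro m' hm'
      have h1 := hmax (m + m') ((hF _ _).2 ⟨hmF, hm'⟩)
      have h2 : spp (m : Fin s → ℕ) ⊆ spp ((m + m' : N) : Fin s → ℕ) := by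
        intro i; simp only [mem_spp]; simp; omega
      have h3 := Finset.eq_of_subset_of_card_le h2 h1
      rw [h3]
      intro i; simp only [mem_spp]; simp; tauto
    have hin : ∀ m' : N, spp (m' : Fin s → ℕ) ⊆ spp (m : Fin s → ℕ) → m' ∈ F := by
      intro m' hm'
      have h0 : ∀ n : ℕ, (n + 1) • m ∈ F := by
        intro n
        induction n with
        | zero => simpa using hmF
        | succ n ih => rw [succ_nsmul]; exact (hF _ _).2 ⟨ih, hmF⟩
      have hle : (m' : Fin s → ℕ) ≤ (dg (m' : Fin s → ℕ) + 1) • (m : Fin s → ℕ) := by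
        intro i
        by_cases hi : (m' : Fin s → ℕ) i = 0
        · rw [hi]; exact Nat.zero_le _
        · have h1 := hm' ((mem_spp _ i).2 hi)
          rw [mem_spp] at h1
          have h2 : (m' : Fin s → ℕ) i ≤ dg (m' : Fin s → ℕ) := Finset.single_le_sum (f := (m' : Fin s → ℕ)) (fun _ _ => Nat.zero_le _) (Finset.mem_univ i)
          simp only [Pi.smul_apply, smul_eq_mul]
          nlinarith [Nat.pos_of_ne_zero h1]
      have hd := hfull _ (N.nsmul_mem m.2 (dg (m' : Fin s → ℕ) + 1)) _ m'.2 hle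
      have he : m' + ⟨_, hd⟩ = (dg (m' : Fin s → ℕ) + 1) • m := by
        apply Subtype.ext
        simp only [AddSubmonoid.coe_add, AddSubmonoidClass.coe_nsmul]
        exact add_tsub_cancel_of_le hle
      exact ((hF _ _).1 (he ▸ h0 _)).1
    have hne : (spp (m : Fin s → ℕ)).Nonempty := by
      by_contra h
      rw [Finset.not_nonempty_iff_eq_empty] at h
      have := hsub a haF
      rw [h, Finset.subset_empty] at this
      apply ha0
      apply Subtype.ext
      funext i
      by_contra hi
      have h2 := (mem_spp _ i).2 hi
      rw [this] at h2
      simp at h2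
    have h1 : 0 < ρ (spp (m : Fin s → ℕ)) :=
      lt_of_le_of_lt (Nat.zero_le _) (rk_strict N (T := ∅) (Finset.empty_ssubset.2 hne) m.2 rfl)
    have h2 : ρ (spp (m : Fin s → ℕ)) ≤ rk N := Submodule.finrank_mono (VT_mono N (Finset.subset_univ _))
    have hP := hμ _ hne ⟨m, m.2, rfl⟩
    refine ⟨⟨ρ (spp (m : Fin s → ℕ)) - 1, by omega⟩, μ (spp (m : Fin s → ℕ)), ?_, ?_, ?_⟩
    · refine Finset.mem_image_of_mem _ ?_
      simp only [Finset.mem_filter, Finset.mem_univ, true_and]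
      exact ⟨⟨hne, m, m.2, rfl⟩, by omega⟩
    · exact hin _ hP.1.le
    · intro m' hm' hm'F
      simp only [Finset.mem_image, Finset.mem_filter, Finset.mem_univ, true_and] at hm'
      obtain ⟨T, ⟨⟨hT1, hT2⟩, hT3⟩, rfl⟩ := hm'
      have hT := hμ T hT1 hT2
      have hs := hsub _ hm'F
      rw [hT.1] at hs
      rcases eq_or_ssubset_of_subset hs with h | h
      · rw [h]
      · have := rk_strict N h m.2 rfl
        simp only [ρ] at hT3 h1
        omega

end Hochster
namespace Hochster
open AddMonoidAlgebra

section theta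
variable {G : Type*} [AddCommMonoid G] (R : Type*) [CommRing R]

/-- The parameter attached to a finite set of monomials. -/
noncomputable def th {d : ℕ} (Θ : Fin d → Finset G) (i : Fin d) : AddMonoidAlgebra R G :=
  ∑ m ∈ Θ i, single m 1

/-- The ideal generated by the parameters. -/
noncomputable def thI {d : ℕ} (Θ : Fin d → Finset G) : Ideal (AddMonoidAlgebra R G) :=
  Ideal.span (Set.range (th R Θ))

/-- Degree n component. -/
noncomputable def pr (deg : G →+ ℕ) (n : ℕ) : AddMonoidAlgebra R G →ₗ[R] AddMonoidAlgebra R G where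
  toFun x := ofCoeff (x.coeff.filter (fun m => deg m = n))
  map_add' x y := by simp [Finsupp.filter_add]
  map_smul' r x := by simp [Finsupp.filter_smul]

lemma pr_single (deg : G →+ ℕ) (n : ℕ) (m : G) (r : R) :
    pr R deg n (single m r) = if deg m = n then single m r else 0 := by
  split_ifs with h
  · simp only [pr, LinearMap.coe_mk, AddHom.coe_mk, coeff_single]
    rw [Finsupp.filter_single_of_pos (fun m => deg m = n) h]; rfl
  · simp only [pr, LinearMap.coe_mk, AddHom.coe_mk, coeff_single]
    rw [Finsupp.filter_single_of_neg (fun m => deg m = n) h]; rfl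

lemma pr_single_mul (deg : G →+ ℕ) (n : ℕ) (m : G) (x : AddMonoidAlgebra R G) :
    pr R deg n (single m 1 * x) =
      if deg m ≤ n then single m 1 * pr R deg (n - deg m) x else 0 := by
  induction x using AddMonoidAlgebra.induction_linear with
  | zero => simp
  | add x y hx hy => rw [mul_add, map_add, hx, hy, map_add]; split_ifs <;> simp [mul_add]
  | single a r =>
    rw [single_mul_single, pr_single, pr_single, map_add]
    split_ifs <;> first | (exfalso; omega) | simp [single_mul_single]

lemma pr_th_mul (deg : G →+ ℕ) {d D : ℕ} {Θ : Fin d → Finset G}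
    (hD : ∀ i, ∀ m ∈ Θ i, deg m = D) (n : ℕ) (i : Fin d) (x : AddMonoidAlgebra R G) :
    pr R deg n (th R Θ i * x) = if D ≤ n then th R Θ i * pr R deg (n - D) x else 0 := by
  rw [th, Finset.sum_mul, map_sum]
  have : ∀ m ∈ Θ i, pr R deg n (single m 1 * x) = if D ≤ n then single m 1 * pr R deg (n - D) x else 0 := by
    intro m hm
    rw [pr_single_mul, hD i m hm]
  rw [Finset.sum_congr rfl this]
  split_ifs <;> simp [Finset.sum_mul]

lemma pr_mem_thI (deg : G →+ ℕ) {d D : ℕ} {Θ : Fin d → Finset G}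
    (hD : ∀ i, ∀ m ∈ Θ i, deg m = D) (n : ℕ) {x : AddMonoidAlgebra R G} (hx : x ∈ thI R Θ) :
    pr R deg n x ∈ thI R Θ := by
  obtain ⟨a, rfl⟩ := (Ideal.mem_span_range_iff_exists_fun).1 hx
  rw [map_sum]
  apply Ideal.sum_mem
  intro i _
  rw [mul_comm, pr_th_mul R deg hD]
  split_ifs
  · exact Ideal.mul_mem_right _ _ (Ideal.subset_span ⟨i, rfl⟩)
  · exact Ideal.zero_mem _

lemma graded_gen (deg : G →+ ℕ) {d D : ℕ} {Θ : Fin d → Finset G} (hD0 : 0 < D)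
    (hD : ∀ i, ∀ m ∈ Θ i, deg m = D) (W U : Submodule R (AddMonoidAlgebra R G))
    (hU : ∀ n, ∀ x ∈ U, pr R deg n x ∈ W)
    (hW : ∀ i, ∀ x ∈ W, th R Θ i * x ∈ W)
    (htop : ∀ x : AddMonoidAlgebra R G, ∃ u ∈ U, x - u ∈ thI R Θ) : W = ⊤ := by
  have key : ∀ n, ∀ x, pr R deg n x ∈ W := by
    intro n
    induction n using Nat.strong_induction_on with
    | _ n ih =>
      intro x
      obtain ⟨u, hu, hxu⟩ := htop x
      obtain ⟨a, ha⟩ := (Ideal.mem_span_range_iff_exists_fun).1 hxu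
      rw [← sub_add_cancel x u, map_add, ← ha, map_sum]
      refine W.add_mem (W.sum_mem fun i _ => ?_) (hU n u hu)
      rw [mul_comm, pr_th_mul R deg hD]
      split_ifs with h
      · exact hW _ _ (ih _ (by omega) _)
      · exact W.zero_mem
  rw [eq_top_iff]
  rintro x -
  induction x using AddMonoidAlgebra.induction_linear with
  | zero => exact W.zero_mem
  | add x y hx hy => exact W.add_mem hx hy
  | single a r =>
    have := key (deg a) (single a r)
    rwa [pr_single, if_pos rfl] at this

/-- The face condition -/
def FaceCond {d : ℕ} (Θ : Fin d → Finset G) : Prop :=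
  ∀ F : Set G, (∀ a b, a + b ∈ F ↔ a ∈ F ∧ b ∈ F) → (∃ a ∈ F, a ≠ 0) →
        ∃ i, ∃ m ∈ Θ i, m ∈ F ∧ ∀ m' ∈ Θ i, m' ∈ F → m' = m

lemma mem_radical {d : ℕ} {Θ : Fin d → Finset G} (hΘ : FaceCond Θ) {m : G} (hm : m ≠ 0) :
    (single m 1 : AddMonoidAlgebra R G) ∈ (thI R Θ).radical := by
  rw [Ideal.radical_eq_sInf, Ideal.mem_sInf]
  rintro P ⟨hP, hPp⟩
  by_contra hmP
  obtain ⟨i, m₀, hm₀, hF, huniq⟩ := hΘ {m | (single m 1 : AddMonoidAlgebra R G) ∉ P} (by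
    intro a b
    simp only [Set.mem_ofPred_eq]
    rw [← not_or, not_iff_not, ← hPp.mul_mem_iff_mem_or_mem, single_mul_single, one_mul]) ⟨m, hmP, hm⟩
  apply hF
  have h1 : th R Θ i ∈ P := hP (Ideal.subset_span ⟨i, rfl⟩)
  classical
  rw [th, ← Finset.add_sum_erase _ _ hm₀] at h1
  refine (Ideal.add_mem_iff_left _ ?_).1 h1
  refine Ideal.sum_mem _ fun m' hm' => ?_
  by_contra h
  exact (Finset.mem_erase.1 hm').1 (huniq _ (Finset.mem_erase.1 hm').2 h)

lemma exists_finite_gen {d : ℕ} {Θ : Fin d → Finset G} (hΘ : FaceCond Θ) (hfg : AddMonoid.FG G) :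
    ∃ E : Finset G, ∀ m : G, m ∉ E → (single m 1 : AddMonoidAlgebra R G) ∈ thI R Θ := by
  classical
  obtain ⟨S, hS⟩ := hfg.fg_top
  have h1 : ∀ g : G, ∃ k : ℕ, g ≠ 0 → (single g 1 : AddMonoidAlgebra R G) ^ k ∈ thI R Θ := by
    intro g
    by_cases hg : g = 0
    · exact ⟨0, fun h => (h hg).elim⟩
    · obtain ⟨k, hk⟩ := mem_radical R hΘ hg
      exact ⟨k, fun _ => hk⟩
  choose k hk using h1
  -- the set of exponents
  let box : Finset (S → ℕ) := Fintype.piFinset (fun g => Finset.range (k g + 1))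
  refine ⟨box.image (fun e => ∑ g : S, e g • (g : G)), ?_⟩
  intro m
  have hmem : ∃ e : S → ℕ, (∀ g : S, (g : G) = 0 → e g = 0) ∧ ∑ g : S, e g • (g : G) = m := by
    have : m ∈ AddSubmonoid.closure (S : Set G) := by rw [hS]; trivial
    induction this using AddSubmonoid.closure_induction with
    | mem x hx =>
      by_cases hx0 : x = 0
      · exact ⟨0, by simp, by simp [hx0]⟩
      · refine ⟨Pi.single ⟨x, hx⟩ 1, ?_, ?_⟩
        · intro g hg
          rw [Pi.single_apply, if_neg]
          rintro rfl
          exact hx0 hg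
        · rw [Finset.sum_eq_single ⟨x, hx⟩]
          · simp
          · intro b _ hb; simp [Pi.single_apply, hb]
          · simp
    | zero => exact ⟨0, by simp, by simp⟩
    | add x y _ _ hx hy =>
      obtain ⟨e, h1, h2⟩ := hx
      obtain ⟨f, h3, h4⟩ := hy
      refine ⟨e + f, fun g hg => by simp [h1 g hg, h3 g hg], ?_⟩
      simp only [Pi.add_apply, add_smul, Finset.sum_add_distrib, h2, h4]
  intro hm
  obtain ⟨e, he0, he⟩ := hmem
  have : ∃ g : S, k g ≤ e g ∧ (g : G) ≠ 0 := by
    by_contra! hcon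
    apply hm
    refine Finset.mem_image.2 ⟨e, ?_, he⟩
    rw [Fintype.mem_piFinset]
    intro g
    rw [Finset.mem_range]
    by_contra hg
    have := he0 g (hcon g (by omega))
    omega
  obtain ⟨g, hg, hg0⟩ := this
  rw [← he, ← Finset.add_sum_erase _ _ (Finset.mem_univ g)]
  have h2 : e g • (g : G) = k g • (g : G) + (e g - k g) • (g : G) := by
    rw [← add_smul]; congr 1; omega
  rw [h2, add_assoc, ← one_mul (1 : R), ← single_mul_single]
  apply Ideal.mul_mem_right
  have := hk g hg0
  rwa [single_pow, one_pow] at this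

/-- The structure map from the polynomial ring. -/
noncomputable def phi {d : ℕ} (Θ : Fin d → Finset G) :
    MvPolynomial (Fin d) R →ₐ[R] AddMonoidAlgebra R G := MvPolynomial.aeval (th R Θ)

lemma phi_finite (deg : G →+ ℕ) {d D : ℕ} {Θ : Fin d → Finset G} (hD0 : 0 < D)
    (hD : ∀ i, ∀ m ∈ Θ i, deg m = D) (hΘ : FaceCond Θ) (hfg : AddMonoid.FG G) :
    (phi R Θ).toRingHom.Finite := by
  classical
  obtain ⟨E, hE⟩ := exists_finite_gen R hΘ hfg
  letI := (phi R Θ).toRingHom.toAlgebra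
  have hst : IsScalarTower R (MvPolynomial (Fin d) R) (AddMonoidAlgebra R G) :=
    IsScalarTower.of_algebraMap_eq' (phi R Θ).comp_algebraMap.symm
  let W : Submodule (MvPolynomial (Fin d) R) (AddMonoidAlgebra R G) :=
    Submodule.span _ ((fun m => (single m 1 : AddMonoidAlgebra R G)) '' (E : Set G))
  have hW : W.restrictScalars R = ⊤ := by
    refine graded_gen R deg hD0 hD _ (Submodule.span R ((fun m => (single m 1 : AddMonoidAlgebra R G)) '' (E : Set G))) ?_ ?_ ?_
    · intro n x hx
      induction hx using Submodule.span_induction with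
      | mem x hx =>
        obtain ⟨m, hm, rfl⟩ := hx
        simp only [pr_single]
        split_ifs
        · exact Submodule.subset_span ⟨m, hm, rfl⟩
        · exact Submodule.zero_mem _
      | zero => simp
      | add x y _ _ hx hy => rw [map_add]; exact Submodule.add_mem _ hx hy
      | smul a x _ hx => rw [map_smul]; exact Submodule.smul_mem _ _ hx
    · intro i x hx
      have h1 : th R Θ i * x = (MvPolynomial.X i : MvPolynomial (Fin d) R) • x := by
        rw [Algebra.smul_def]
        congr 1
        change _ = phi R Θ (MvPolynomial.X i)
        simp [phi]
      rw [h1]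
      exact W.smul_mem _ hx
    · intro x
      induction x using AddMonoidAlgebra.induction_linear with
      | zero => exact ⟨0, Submodule.zero_mem _, by simp⟩
      | add x y hx hy =>
        obtain ⟨u, hu, h1⟩ := hx
        obtain ⟨v, hv, h2⟩ := hy
        refine ⟨u + v, Submodule.add_mem _ hu hv, ?_⟩
        rw [add_sub_add_comm]
        exact Ideal.add_mem _ h1 h2
      | single m r =>
        by_cases hm : m ∈ E
        · refine ⟨single m r, ?_, by simp⟩
          have : (single m r : AddMonoidAlgebra R G) = r • single m 1 := by simp
          rw [this]
          exact Submodule.smul_mem _ _ (Submodule.subset_span ⟨m, hm, rfl⟩)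
        · refine ⟨0, Submodule.zero_mem _, ?_⟩
          have : (single m r : AddMonoidAlgebra R G) = r • single m 1 := by simp
          rw [sub_zero, this]
          exact Submodule.smul_of_tower_mem _ _ (hE m hm)
  change Module.Finite _ _
  refine ⟨⟨E.image (fun m => (single m 1 : AddMonoidAlgebra R G)), ?_⟩⟩
  rw [Finset.coe_image]
  exact (Submodule.restrictScalars_eq_top_iff R _ _).1 hW

end theta
end Hochster
namespace Hochster
open AddMonoidAlgebra

lemma algInd_monomials {s d : ℕ} (N : AddSubmonoid (Fin s → ℕ)) (K : Type*) [CommRing K]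
    (v : Fin d → N) (hv : LinearIndependent ℚ (fun i => qc (v i : Fin s → ℕ))) :
    AlgebraicIndependent K (fun i => (single (v i) 1 : AddMonoidAlgebra K N)) := by
  classical
  let f : (Fin d →₀ ℕ) → N := fun α => α.sum (fun i k => k • v i)
  have hf : Function.Injective f := by
    intro α β h
    have h1 : ∀ α, qc (f α : Fin s → ℕ) = ∑ i, (α i : ℚ) • qc (v i : Fin s → ℕ) := by
      intro α
      funext j
      simp only [f]
      rw [Finsupp.sum_fintype _ _ (fun i => zero_nsmul (v i))]
      simp [qc]
    have h2 : ∑ i, ((α i : ℚ) - β i) • qc (v i : Fin s → ℕ) = 0 := by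
      simp_rw [sub_smul]
      rw [Finset.sum_sub_distrib, ← h1, ← h1, h, sub_self]
    ext i
    have := Fintype.linearIndependent_iff.1 hv _ h2 i
    exact_mod_cast sub_eq_zero.1 this
  have hm : ∀ (β : Fin d →₀ ℕ) (c : K), MvPolynomial.aeval (fun i => (single (v i) 1 : AddMonoidAlgebra K N)) (MvPolynomial.monomial β c) = single (f β) c := by
    intro β c
    rw [MvPolynomial.aeval_monomial]
    simp_rw [single_pow, one_pow]
    rw [AddMonoidAlgebra.finsuppProd_single]
    simp [f, Finsupp.prod]
  have key : ∀ (P : MvPolynomial (Fin d) K) α, (MvPolynomial.aeval (fun i => (single (v i) 1 : AddMonoidAlgebra K N)) P).coeff (f α) = P.coeff α := by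
    intro P α
    induction P using MvPolynomial.induction_on' with
    | monomial β c =>
      rw [hm, coeff_single, Finsupp.single_apply]
      simp only [hf.eq_iff]
      rw [MvPolynomial.coeff_monomial]
    | add p q hp hq => rw [map_add]; simp [hp, hq]
  intro P Q h
  ext α
  rw [← key, ← key]
  exact congrArg (fun z => z.coeff (f α)) h

instance noZD {s : ℕ} (N : AddSubmonoid (Fin s → ℕ)) (K : Type*) [Field K] :
    IsDomain (AddMonoidAlgebra K N) := by
  have : UniqueSums N := UniqueSums.of_injective_addHom (N.subtype : N →ₙ+ (Fin s → ℕ)) Subtype.val_injective inferInstance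
  exact NoZeroDivisors.to_isDomain _

lemma exists_basis {s : ℕ} (N : AddSubmonoid (Fin s → ℕ)) :
    ∃ v : Fin (rk N) → N, LinearIndependent ℚ (fun i => qc (v i : Fin s → ℕ)) := by
  obtain ⟨b, hb, hspan, hli⟩ := exists_linearIndependent ℚ (qc '' {m | m ∈ N ∧ spp m ⊆ Finset.univ})
  have hfin : Fintype b := hli.setFinite.fintype
  have hcard : Fintype.card b = rk N := by
    rw [rk, VT, ← hspan]
    have := finrank_span_eq_card hli
    rw [Subtype.range_coe] at this
    exact this.symm
  let e : Fin (rk N) ≃ b := (Fintype.equivFinOfCardEq hcard).symm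
  have hx : ∀ x : b, ∃ n : N, qc (n : Fin s → ℕ) = x := by
    intro x
    obtain ⟨m, hm, h⟩ := hb x.2
    exact ⟨⟨m, hm.1⟩, h⟩
  choose n hn using hx
  refine ⟨fun i => n (e i), ?_⟩
  simp_rw [hn]
  exact hli.comp e e.injective

lemma phi_injective {s : ℕ} (N : AddSubmonoid (Fin s → ℕ)) (K : Type*) [Field K]
    (Θ : Fin (rk N) → Finset N) (hfin : (phi K Θ).toRingHom.Finite) :
    Function.Injective (phi K Θ) := by
  obtain ⟨v, hv⟩ := exists_basis N
  have h1 := (algInd_monomials N K v hv).lift_cardinalMk_le_trdeg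
  have h2 : Algebra.IsAlgebraic (Algebra.adjoin K (Set.range (th K Θ))) (AddMonoidAlgebra K N) := by
    have : Algebra.IsIntegral (Algebra.adjoin K (Set.range (th K Θ))) (AddMonoidAlgebra K N) := by
      rw [← algebraMap_isIntegral_iff]
      have hmem : ∀ x, phi K Θ x ∈ Algebra.adjoin K (Set.range (th K Θ)) := by
        intro x
        rw [Algebra.adjoin_range_eq_range_aeval]
        exact ⟨x, rfl⟩
      refine RingHom.IsIntegral.tower_top ((phi K Θ).codRestrict _ hmem).toRingHom _ ?_
      exact hfin.to_isIntegral
    exact Algebra.IsIntegral.isAlgebraic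
  have h3 := Algebra.IsAlgebraic.isTranscendenceBasis_of_lift_le_trdeg_of_finite K (th K Θ) (by simpa using h1)
  exact h3.1

end Hochster
namespace Hochster
open AddMonoidAlgebra

lemma poly_colon {σ K : Type*} [CommRing K] (q : ℕ) (s : Finset σ) (k : σ) (hk : k ∉ s)
    (P : MvPolynomial σ K)
    (h : MvPolynomial.X k ^ q * P ∈ Ideal.span ((fun i => (MvPolynomial.X i : MvPolynomial σ K) ^ q) '' (s : Set σ))) :
    P ∈ Ideal.span ((fun i => (MvPolynomial.X i : MvPolynomial σ K) ^ q) '' (s : Set σ)) := by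
  classical
  have he : ((fun i => (MvPolynomial.X i : MvPolynomial σ K) ^ q) '' (s : Set σ)) =
      (fun α => MvPolynomial.monomial α (1 : K)) '' ((fun i => Finsupp.single i q) '' (s : Set σ)) := by
    rw [Set.image_image]
    simp_rw [MvPolynomial.X_pow_eq_monomial]
  rw [he, MvPolynomial.mem_ideal_span_monomial_image] at h ⊢
  intro α hα
  obtain ⟨β, ⟨i, hi, rfl⟩, hβ⟩ := h (Finsupp.single k q + α) (by
    rw [MvPolynomial.X_pow_eq_monomial]
    rw [MvPolynomial.mem_support_iff] at hα ⊢
    rwa [MvPolynomial.coeff_monomial_mul, one_mul])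
  refine ⟨_, ⟨i, hi, rfl⟩, ?_⟩
  have hik : k ≠ i := by rintro rfl; exact hk hi
  rw [Finsupp.single_le_iff] at hβ ⊢
  simpa [Finsupp.single_apply, hik] using hβ

lemma exists_of_mem_span {A ι : Type*} [CommRing A] {f : ι → A} {t : Finset ι} {x : A}
    (h : x ∈ Ideal.span (f '' (t : Set ι))) : ∃ a : ι → A, ∑ i ∈ t, a i * f i = x := by
  classical
  obtain ⟨a, ha⟩ := (Submodule.mem_span_image_finset_iff_exists_fun _).1 h
  refine ⟨fun i => if h : i ∈ t then a ⟨i, h⟩ else 0, ?_⟩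
  rw [← ha, ← Finset.sum_coe_sort]
  simp

lemma exists_free_sub (B A : Type*) [CommRing B] [IsDomain B] [CommRing A] [IsDomain A] [Algebra B A]
    [Module.Finite B A] (hinj : Function.Injective (algebraMap B A)) :
    ∃ (ι : Type) (e : ι → A) (c : A), LinearIndependent B e ∧ c ≠ 0 ∧
      ∀ a, c * a ∈ Submodule.span B (Set.range e) := by
  classical
  obtain ⟨n, g, hg⟩ := Module.Finite.exists_fin (R := B) (M := A)
  obtain ⟨s, hs, hmax⟩ := exists_maximal_linearIndepOn B g
  have h1 : ∀ i, ∃ a : B, a ≠ 0 ∧ a • g i ∈ Submodule.span B (g '' s) := by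
    intro i
    by_cases hi : i ∈ s
    · exact ⟨1, one_ne_zero, by rw [one_smul]; exact Submodule.subset_span ⟨i, hi, rfl⟩⟩
    · exact hmax i hi
  choose a ha0 ha using h1
  refine ⟨s, fun i => g i, algebraMap B A (∏ i, a i), hs, ?_, ?_⟩
  · rw [Ne, map_eq_zero_iff _ hinj]
    exact Finset.prod_ne_zero_iff.2 fun i _ => ha0 i
  · intro x
    have hr : Set.range (fun i : s => g i) = g '' s := by
      rw [Set.image_eq_range]
    rw [← Algebra.smul_def, hr]
    have hx : x ∈ Submodule.span B (Set.range g) := by rw [hg]; trivial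
    induction hx using Submodule.span_induction with
    | mem x hx =>
      obtain ⟨i, rfl⟩ := hx
      rw [← Finset.prod_erase_mul _ _ (Finset.mem_univ i), mul_smul]
      exact Submodule.smul_mem _ _ (ha i)
    | zero => simp
    | add x y _ _ hx hy => rw [smul_add]; exact Submodule.add_mem _ hx hy
    | smul b x _ hx => rw [smul_comm]; exact Submodule.smul_mem _ _ hx

section frob
variable {s : ℕ} {N : AddSubmonoid (Fin s → ℕ)}

lemma shift_inj (m : N) {q : ℕ} (hq : 0 < q) : Function.Injective (fun w : N => m + q • w) := by
  intro a b h
  apply Subtype.ext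
  funext i
  have := congrFun (congrArg Subtype.val h) i
  simp only [AddSubmonoid.coe_add, AddSubmonoidClass.coe_nsmul, Pi.add_apply, Pi.smul_apply, smul_eq_mul] at this
  exact Nat.eq_of_mul_eq_mul_left hq (by omega)

/-- The Cartier-type operator. -/
noncomputable def psi (K : Type*) [CommRing K] (m : N) {q : ℕ} (hq : 0 < q) :
    AddMonoidAlgebra K N →+ AddMonoidAlgebra K N :=
  comapDomainAddMonoidHom (fun w : N => m + q • w) (shift_inj m hq)

lemma psi_coeff (K : Type*) [CommRing K] (m : N) {q : ℕ} (hq : 0 < q) (f : AddMonoidAlgebra K N) (w : N) :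
    (psi K m hq f).coeff w = f.coeff (m + q • w) := by
  rfl

lemma psi_mul (hfull : ∀ a ∈ N, ∀ b ∈ N, b ≤ a → a - b ∈ N) (p : ℕ) [Fact p.Prime] (e : ℕ)
    (m : N) (hq : 0 < p ^ e) (hm : ∀ i, (m : Fin s → ℕ) i < p ^ e) (g f : AddMonoidAlgebra (ZMod p) N) :
    psi (ZMod p) m hq (g ^ (p ^ e) * f) = g * psi (ZMod p) m hq f := by
  classical
  have : CharP (AddMonoidAlgebra (ZMod p) N) p :=
    charP_of_injective_algebraMap (algebraMap (ZMod p) (AddMonoidAlgebra (ZMod p) N)).injective p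
  induction g using AddMonoidAlgebra.induction_linear with
  | zero => rw [zero_pow hq.ne']; simp
  | add x y hx hy => rw [add_pow_char_pow, add_mul, map_add, hx, hy, add_mul]
  | single n r =>
    rw [single_pow, ZMod.pow_card_pow]
    induction f using AddMonoidAlgebra.induction_linear with
    | zero => simp
    | add x y hx hy => rw [mul_add, map_add, hx, hy, map_add, mul_add]
    | single u t =>
      rw [single_mul_single]
      by_cases hu : u ∈ Set.range (fun w : N => m + (p ^ e) • w)
      · obtain ⟨w, rfl⟩ := hu
        have h1 : (p ^ e) • n + (m + (p ^ e) • w) = m + (p ^ e) • (n + w) := by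
          rw [smul_add]; abel
        simp only [h1, psi, comapDomainAddMonoidHom, AddMonoidHom.coe_mk, ZeroHom.coe_mk]
        rw [comapDomain_single_map (fun w : N => m + (p ^ e) • w), comapDomain_single_map (fun w : N => m + (p ^ e) • w), single_mul_single]
      · have h2 : (p ^ e) • n + u ∉ Set.range (fun w : N => m + (p ^ e) • w) := by
          rintro ⟨w, hw⟩
          apply hu
          have hw' : ∀ i, (m : Fin s → ℕ) i + p ^ e * (w : Fin s → ℕ) i = p ^ e * (n : Fin s → ℕ) i + (u : Fin s → ℕ) i := by
            intro i
            have := congrFun (congrArg Subtype.val hw) i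
            simpa only [AddSubmonoid.coe_add, AddSubmonoidClass.coe_nsmul, Pi.add_apply, Pi.smul_apply, smul_eq_mul] using this
          have hle : (n : Fin s → ℕ) ≤ w := by
            intro i
            by_contra hlt
            rw [not_le] at hlt
            have h3 := Nat.mul_le_mul_left (p ^ e) hlt
            rw [Nat.mul_succ] at h3
            have := hw' i
            have := hm i
            omega
          refine ⟨⟨_, hfull _ w.2 _ n.2 hle⟩, ?_⟩
          apply Subtype.ext
          funext i
          simp only [AddSubmonoid.coe_add, AddSubmonoidClass.coe_nsmul, Pi.add_apply, Pi.smul_apply, smul_eq_mul, Pi.sub_apply]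
          have h4 := hw' i
          have h5 := Nat.mul_le_mul_left (p ^ e) (hle i)
          rw [Nat.mul_sub]
          omega
        have h0 : ∀ (v : N) (r : ZMod p), v ∉ Set.range (fun w : N => m + (p ^ e) • w) →
            psi (ZMod p) m hq (single v r) = 0 := by
          intro v r hv
          ext w
          rw [psi_coeff, coeff_single, Finsupp.single_apply, if_neg]
          · rfl
          · rintro rfl
            exact hv ⟨w, rfl⟩
        rw [h0 _ _ hu, h0 _ _ h2, mul_zero]

lemma psi_unit (K : Type*) [CommRing K] {q : ℕ} (hq : 0 < q) (c : AddMonoidAlgebra K N) (m : N)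
    (hc : ∀ u ∈ c.coeff.support, ∀ i, (u : Fin s → ℕ) i < q) :
    psi K m hq c = single 0 (c.coeff m) := by
  classical
  ext w
  rw [psi_coeff, coeff_single, Finsupp.single_apply]
  split_ifs with h
  · subst h; simp
  · by_contra hne
    apply h
    apply Subtype.ext
    funext i
    have := hc _ (Finsupp.mem_support_iff.2 hne) i
    simp only [AddSubmonoid.coe_add, AddSubmonoidClass.coe_nsmul, Pi.add_apply, Pi.smul_apply, smul_eq_mul] at this
    change 0 = (w : Fin s → ℕ) i
    rcases Nat.eq_zero_or_pos ((w : Fin s → ℕ) i) with h0 | h0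
    · exact h0.symm
    · nlinarith

lemma theta_colon (hfull : ∀ a ∈ N, ∀ b ∈ N, b ≤ a → a - b ∈ N) (p : ℕ) [Fact p.Prime] {d : ℕ}
    (Θ : Fin d → Finset N) (hfin : (phi (ZMod p) Θ).toRingHom.Finite)
    (hinj : Function.Injective (phi (ZMod p) Θ)) (t : Finset (Fin d)) (k : Fin d) (hk : k ∉ t)
    (z : AddMonoidAlgebra (ZMod p) N)
    (hz : th (ZMod p) Θ k * z ∈ Ideal.span (th (ZMod p) Θ '' (t : Set (Fin d)))) :
    z ∈ Ideal.span (th (ZMod p) Θ '' (t : Set (Fin d))) := by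
  classical
  let := (phi (ZMod p) Θ).toRingHom.toAlgebra
  have : Module.Finite (MvPolynomial (Fin d) (ZMod p)) (AddMonoidAlgebra (ZMod p) N) := hfin
  have : CharP (AddMonoidAlgebra (ZMod p) N) p :=
    charP_of_injective_algebraMap (algebraMap (ZMod p) (AddMonoidAlgebra (ZMod p) N)).injective p
  obtain ⟨ι, e, c, hli, hc0, hc⟩ := exists_free_sub (MvPolynomial (Fin d) (ZMod p)) (AddMonoidAlgebra (ZMod p) N) hinj
  have hX : ∀ i, algebraMap (MvPolynomial (Fin d) (ZMod p)) (AddMonoidAlgebra (ZMod p) N) (MvPolynomial.X i) = th (ZMod p) Θ i := by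
    intro i
    change phi (ZMod p) Θ (MvPolynomial.X i) = _
    simp [phi]
  -- bound
  let b := c.coeff.support.sup (fun u : N => dg (u : Fin s → ℕ))
  have hb : ∀ u ∈ c.coeff.support, ∀ i, (u : Fin s → ℕ) i < p ^ b := by
    intro u hu i
    have h1 : (u : Fin s → ℕ) i ≤ dg (u : Fin s → ℕ) := Finset.single_le_sum (f := (u : Fin s → ℕ)) (fun _ _ => Nat.zero_le _) (Finset.mem_univ i)
    have h2 : dg (u : Fin s → ℕ) ≤ b := Finset.le_sup (f := fun u : N => dg (u : Fin s → ℕ)) hu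
    have h3 : b < p ^ b := Nat.lt_pow_self (Fact.out : p.Prime).one_lt
    omega
  have hq : 0 < p ^ b := pow_pos (Fact.out : p.Prime).pos _
  obtain ⟨m, hm⟩ : ∃ m, m ∈ c.coeff.support := by
    rw [← Finset.nonempty_def, Finsupp.support_nonempty_iff]
    simpa using hc0
  -- the colon step
  have key : c * z ^ (p ^ b) ∈ Ideal.span ((fun i => th (ZMod p) Θ i ^ (p ^ b)) '' (t : Set (Fin d))) := by
    obtain ⟨a, ha⟩ := exists_of_mem_span hz
    have h1 : c * (th (ZMod p) Θ k * z) ^ (p ^ b) = ∑ i ∈ t, th (ZMod p) Θ i ^ (p ^ b) * (c * a i ^ (p ^ b)) := by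
      rw [← ha, sum_pow_char_pow, Finset.mul_sum]
      refine Finset.sum_congr rfl fun i _ => ?_
      rw [mul_pow]; ring
    obtain ⟨P, hP⟩ := Finsupp.mem_span_range_iff_exists_finsupp.1 (hc (z ^ (p ^ b)))
    have h2 := fun i => Finsupp.mem_span_range_iff_exists_finsupp.1 (hc (a i ^ (p ^ b)))
    choose Q hQ using h2
    have h3 : (MvPolynomial.X k : MvPolynomial (Fin d) (ZMod p)) ^ (p ^ b) • P = ∑ i ∈ t, (MvPolynomial.X i : MvPolynomial (Fin d) (ZMod p)) ^ (p ^ b) • Q i := by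
      apply hli
      rw [map_smul, map_sum]
      simp_rw [map_smul, Finsupp.linearCombination_apply, hQ, hP, Algebra.smul_def, map_pow, hX]
      rw [← h1, mul_pow]; ring
    rw [← hP]
    refine Ideal.sum_mem _ fun j _ => ?_
    have h4 : P j ∈ Ideal.span ((fun i => (MvPolynomial.X i : MvPolynomial (Fin d) (ZMod p)) ^ (p ^ b)) '' (t : Set (Fin d))) := by
      apply poly_colon _ t k hk
      have := DFunLike.congr_fun h3 j
      rw [Finsupp.smul_apply, smul_eq_mul] at this
      rw [this, Finsupp.finsetSum_apply]
      refine Ideal.sum_mem _ fun i hi => ?_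
      exact Ideal.mul_mem_right _ _ (Ideal.subset_span ⟨i, hi, rfl⟩)
    simp only [Algebra.smul_def]
    apply Ideal.mul_mem_right
    have h5 := Ideal.mem_map_of_mem (algebraMap (MvPolynomial (Fin d) (ZMod p)) (AddMonoidAlgebra (ZMod p) N)) h4
    rw [Ideal.map_span, Set.image_image] at h5
    simpa only [map_pow, hX] using h5
  obtain ⟨a, ha⟩ := exists_of_mem_span key
  have h6 : z * psi (ZMod p) m hq c = ∑ i ∈ t, th (ZMod p) Θ i * psi (ZMod p) m hq (a i) := by
    rw [← psi_mul hfull p b m hq (hb m hm), mul_comm, ← ha, map_sum]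
    refine Finset.sum_congr rfl fun i _ => ?_
    rw [mul_comm, psi_mul hfull p b m hq (hb m hm)]
  rw [psi_unit (ZMod p) hq c m hb] at h6
  have hcm : c.coeff m ≠ 0 := Finsupp.mem_support_iff.1 hm
  have h7 : z = (z * single 0 (c.coeff m)) * single 0 (c.coeff m)⁻¹ := by
    rw [mul_assoc, single_mul_single, mul_inv_cancel₀ hcm, add_zero, ← one_def, mul_one]
  rw [h7, h6]
  apply Ideal.mul_mem_right
  refine Ideal.sum_mem _ fun i hi => ?_
  exact Ideal.mul_mem_right _ _ (Ideal.subset_span ⟨i, hi, rfl⟩)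

end frob
end Hochster
namespace Hochster
open AddMonoidAlgebra

section WR
variable {A : Type*} [CommRing A]

/-- Weakly regular sequences modulo an ideal. -/
def WR : (n : ℕ) → Ideal A → (Fin n → A) → Prop
  | 0, _, _ => True
  | n + 1, U, t => (∀ x, t 0 * x ∈ U → x ∈ U) ∧ WR n (U ⊔ Ideal.span {t 0}) (fun i => t i.succ)

lemma range_succ_eq {n : ℕ} (t : Fin (n + 1) → A) :
    Set.range t = {t 0} ∪ Set.range (fun i : Fin n => t i.succ) := by
  ext x
  simp [Fin.exists_fin_succ, eq_comm]

lemma span_range_succ {n : ℕ} (U : Ideal A) (t : Fin (n + 1) → A) :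
    U ⊔ Ideal.span (Set.range t) =
      (U ⊔ Ideal.span {t 0}) ⊔ Ideal.span (Set.range (fun i : Fin n => t i.succ)) := by
  rw [range_succ_eq, Ideal.span_union, sup_assoc]

lemma WR_of_colon {n : ℕ} (U : Ideal A) (t : Fin n → A)
    (h : ∀ (s : Finset (Fin n)) (k : Fin n), k ∉ s → ∀ x, t k * x ∈ U ⊔ Ideal.span (t '' (s : Set (Fin n))) →
      x ∈ U ⊔ Ideal.span (t '' (s : Set (Fin n)))) : WR n U t := by
  classical
  induction n generalizing U with
  | zero => trivial
  | succ n ih =>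
    refine ⟨fun x hx => ?_, ih _ _ ?_⟩
    · simpa using h ∅ 0 (by simp) x (by simpa using hx)
    · intro s k hk x hx
      have he : U ⊔ Ideal.span {t 0} ⊔ Ideal.span ((fun i : Fin n => t i.succ) '' (s : Set (Fin n))) =
          U ⊔ Ideal.span (t '' ((insert 0 (s.image Fin.succ) : Finset (Fin (n + 1))) : Set (Fin (n + 1)))) := by
        rw [sup_assoc, ← Ideal.span_union]
        congr 2
        rw [Finset.coe_insert, Finset.coe_image, Set.image_insert_eq, Set.image_image]
        rfl
      rw [he] at hx ⊢
      refine h _ k.succ ?_ x hx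
      simp [Fin.succ_ne_zero, hk]

lemma WR_p {n : ℕ} (U : Ideal A) (t : Fin n → A) (p : A) (hp : ∀ x, p * x ∈ U → x ∈ U)
    (h : WR n (U ⊔ Ideal.span {p}) t) :
    ∀ x, p * x ∈ U ⊔ Ideal.span (Set.range t) → x ∈ U ⊔ Ideal.span (Set.range t) := by
  induction n generalizing U with
  | zero => simpa using hp
  | succ n ih =>
    rw [span_range_succ]
    apply ih
    · intro x hx
      obtain ⟨u, hu, v, hv, huv⟩ := Submodule.mem_sup.1 hx
      obtain ⟨a, rfl⟩ := Ideal.mem_span_singleton'.1 hv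
      have h1 : t 0 * a ∈ U ⊔ Ideal.span {p} := by
        refine Submodule.mem_sup.2 ⟨-u, U.neg_mem hu, p * x, Ideal.mul_mem_right _ _ (Ideal.mem_span_singleton_self p), ?_⟩
        rw [← huv]; ring
      obtain ⟨u', hu', w, hw, huw⟩ := Submodule.mem_sup.1 (h.1 _ h1)
      obtain ⟨a', rfl⟩ := Ideal.mem_span_singleton'.1 hw
      have h2 : p * (x - t 0 * a') ∈ U := by
        have : p * (x - t 0 * a') = u + u' * t 0 := by
          rw [mul_sub, ← huv, ← huw]; ring
        rw [this]
        exact U.add_mem hu (U.mul_mem_right _ hu')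
      refine Submodule.mem_sup.2 ⟨_, hp _ h2, t 0 * a', Ideal.mul_mem_right _ _ (Ideal.mem_span_singleton_self _), by ring⟩
    · have := h.2
      rwa [sup_right_comm] at this

/-- Independence modulo p. -/
def PI (p : ℤ) {J : Type*} (U : Ideal A) (f : J → A) : Prop :=
  ∀ c : J →₀ ℤ, Finsupp.linearCombination ℤ f c ∈ U → ∀ j, p ∣ c j

lemma PI_reindex {p : ℤ} {J J' : Type*} {U : Ideal A} {f : J → A} (h : PI p U f) (e : J' → J)
    (he : Function.Injective e) (g : J' → A) (hg : ∀ j, g j = f (e j)) : PI p U g := by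
  intro c hc j
  have := h (c.mapDomain e) (by
    rw [Finsupp.linearCombination_mapDomain]
    have hgf : g = f ∘ e := funext hg
    rwa [← hgf]) (e j)
  rwa [Finsupp.mapDomain_apply he] at this

lemma PI_step {p : ℤ} {J : Type*} {U : Ideal A} {f : J → A} (hp : (p : A) ∈ U) (t : A)
    (ht : ∀ x, t * x ∈ U → x ∈ U) (h : PI p (U ⊔ Ideal.span {t}) f) :
    PI p U (fun x : ℕ × J => t ^ x.1 * f x.2) := by
  classical
  have i0 : Function.Injective (fun j : J => ((0, j) : ℕ × J)) := fun a b h => by simpa using h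
  have i1 : Function.Injective (fun x : ℕ × J => ((x.1 + 1, x.2) : ℕ × J)) := fun a b h => by
    simpa [Prod.ext_iff] using h
  have dec : ∀ c : ℕ × J →₀ ℤ, Finsupp.linearCombination ℤ (fun x : ℕ × J => t ^ x.1 * f x.2) c =
      Finsupp.linearCombination ℤ f (c.comapDomain _ i0.injOn) +
      t * Finsupp.linearCombination ℤ (fun x : ℕ × J => t ^ x.1 * f x.2) (c.comapDomain _ i1.injOn) := by
    intro c
    induction c using Finsupp.induction_linear with
    | zero => simp
    | add x y hx hy =>
      rw [map_add, hx, hy, Finsupp.comapDomain_add_of_injective i0, Finsupp.comapDomain_add_of_injective i1, map_add, map_add]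
      ring
    | single x r =>
      obtain ⟨n, j⟩ := x
      cases n with
      | zero =>
        have e0 : (Finsupp.single ((0, j) : ℕ × J) r).comapDomain (fun j : J => ((0, j) : ℕ × J)) i0.injOn = Finsupp.single j r :=
          Finsupp.comapDomain_single (f := fun j : J => ((0, j) : ℕ × J)) j r i0.injOn
        have e1 : (Finsupp.single ((0, j) : ℕ × J) r).comapDomain (fun x : ℕ × J => ((x.1 + 1, x.2) : ℕ × J)) i1.injOn = 0 := by
          ext x; simp [Finsupp.single_apply]
        rw [e0, e1]; simp
      | succ n =>
        have e0 : (Finsupp.single ((n + 1, j) : ℕ × J) r).comapDomain (fun j : J => ((0, j) : ℕ × J)) i0.injOn = 0 := by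
          ext x; simp [Finsupp.single_apply]
        have e1 : (Finsupp.single ((n + 1, j) : ℕ × J) r).comapDomain (fun x : ℕ × J => ((x.1 + 1, x.2) : ℕ × J)) i1.injOn = Finsupp.single (n, j) r :=
          Finsupp.comapDomain_single (f := fun x : ℕ × J => ((x.1 + 1, x.2) : ℕ × J)) (n, j) r i1.injOn
        rw [e0, e1]; simp [pow_succ]; ring
  have key : ∀ c : ℕ × J →₀ ℤ, Finsupp.linearCombination ℤ (fun x : ℕ × J => t ^ x.1 * f x.2) c ∈ U →
      ∀ j, p ∣ c (0, j) := by
    intro c hc j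
    refine h (c.comapDomain _ i0.injOn) ?_ j
    rw [dec] at hc
    refine Submodule.mem_sup.2 ⟨_, hc, -(t * Finsupp.linearCombination ℤ (fun x : ℕ × J => t ^ x.1 * f x.2) (c.comapDomain _ i1.injOn)), ?_, by ring⟩
    exact Ideal.neg_mem_iff _ |>.2 (Ideal.mul_mem_right _ _ (Ideal.mem_span_singleton_self _))
  have key2 : ∀ n : ℕ, ∀ c : ℕ × J →₀ ℤ, Finsupp.linearCombination ℤ (fun x : ℕ × J => t ^ x.1 * f x.2) c ∈ U →
      ∀ j, p ∣ c (n, j) := by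
    intro n
    induction n with
    | zero => exact key
    | succ n ih =>
      intro c hc j
      refine ih (c.comapDomain _ i1.injOn) ?_ j
      apply ht
      have h0 := key c hc
      rw [dec] at hc
      refine (Ideal.add_mem_iff_right _ ?_).1 hc
      rw [Finsupp.linearCombination_apply]
      refine Ideal.sum_mem _ fun j _ => ?_
      obtain ⟨r, hr⟩ := h0 j
      have hr' : (c.comapDomain _ i0.injOn) j = p * r := hr
      rw [hr']
      beta_reduce
      rw [zsmul_eq_mul, Int.cast_mul, mul_assoc]
      exact Ideal.mul_mem_right _ _ hp
  intro c hc j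
  exact key2 j.1 c hc j.2

lemma PI_multi {p : ℤ} {J : Type*} {n : ℕ} {U : Ideal A} {f : J → A} (hp : (p : A) ∈ U) (t : Fin n → A)
    (ht : WR n U t) (h : PI p (U ⊔ Ideal.span (Set.range t)) f) :
    PI p U (fun x : (Fin n → ℕ) × J => (∏ i, t i ^ x.1 i) * f x.2) := by
  induction n generalizing U with
  | zero =>
    refine PI_reindex (f := f) (by simpa using h) Prod.snd ?_ _ ?_
    · intro a b hab
      exact Prod.ext (Subsingleton.elim _ _) hab
    · intro j; simp
  | succ n ih =>
    rw [span_range_succ] at h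
    have h1 := ih (Ideal.mem_sup_left hp) (fun i => t i.succ) ht.2 h
    have h2 := PI_step hp (t 0) ht.1 h1
    refine PI_reindex h2 (fun x => (x.1 0, (fun i => x.1 i.succ, x.2))) ?_ _ ?_
    · rintro ⟨a, j⟩ ⟨b, j'⟩ hab
      simp only [Prod.mk.injEq] at hab
      refine Prod.ext ?_ hab.2.2
      funext i
      refine Fin.cases hab.1 (fun i => congrFun hab.2.1 i) i
    · rintro ⟨a, j⟩
      simp only [Fin.prod_univ_succ]
      ring

lemma li_of_PI {p : ℤ} {J : Type*} {f : J → A} (hp1 : 1 < p) (hreg : ∀ x : A, (p : A) * x = 0 → x = 0)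
    (h : PI p (Ideal.span {(p : A)}) f) : LinearIndependent ℤ f := by
  rw [linearIndependent_iff]
  have key : ∀ k : ℕ, ∀ c : J →₀ ℤ, Finsupp.linearCombination ℤ f c = 0 → ∀ j, p ^ k ∣ c j := by
    intro k
    induction k with
    | zero => simp
    | succ k ih =>
      intro c hc j
      have h1 := h c (by rw [hc]; exact Ideal.zero_mem _)
      let c' : J →₀ ℤ := c.mapRange (fun z => z / p) (by simp)
      have hcc : c = p • c' := by
        ext j
        simp only [c', Finsupp.smul_apply, Finsupp.mapRange_apply, smul_eq_mul]
        exact (Int.mul_ediv_cancel' (h1 j)).symm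
      have h2 : Finsupp.linearCombination ℤ f c' = 0 := by
        apply hreg
        rw [← zsmul_eq_mul, ← map_smul, ← hcc, hc]
      rw [hcc, Finsupp.smul_apply, smul_eq_mul, pow_succ']
      exact mul_dvd_mul_left _ (ih c' h2 j)
  intro c hc
  ext j
  by_contra hne
  have := Int.le_of_dvd (abs_pos.2 hne) ((dvd_abs _ _).2 (key (c j).natAbs c hc j))
  have h2 : ((c j).natAbs : ℤ) < p ^ (c j).natAbs := by
    have h3 : ((c j).natAbs) < 2 ^ (c j).natAbs := Nat.lt_two_pow_self
    have h4 : (2 : ℤ) ^ (c j).natAbs ≤ p ^ (c j).natAbs := pow_le_pow_left₀ (by norm_num) (by omega) _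
    have h5 : ((c j).natAbs : ℤ) < 2 ^ (c j).natAbs := by exact_mod_cast h3
    omega
  rw [Int.abs_eq_natAbs] at this
  omega

end WR
end Hochster
namespace Hochster
open AddMonoidAlgebra

section dual
universe u
variable {G : Type u} [AddCommMonoid G]

lemma pr_pr (deg : G →+ ℕ) (n : ℕ) (x : AddMonoidAlgebra ℤ G) (k : ℕ) :
    pr ℤ deg k (pr ℤ deg n x) = if n = k then pr ℤ deg n x else 0 := by
  induction x using AddMonoidAlgebra.induction_linear with
  | zero => simp
  | add x y hx hy => rw [map_add, map_add, hx, hy]; split_ifs <;> simp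
  | single a r =>
    rw [pr_single]
    by_cases h1 : deg a = n
    · rw [if_pos h1, pr_single, h1]
    · rw [if_neg h1]; simp

/-- A homogeneous family lifting a basis of the quotient, with the dual functionals. -/
lemma exists_dual (deg : G →+ ℕ) {d D : ℕ} {Θ : Fin d → Finset G}
    (hD : ∀ i, ∀ m ∈ Θ i, deg m = D) (hΘ : FaceCond Θ) (hfg : AddMonoid.FG G)
    (htf : ∀ n : ℕ, n.Prime → ∀ x : AddMonoidAlgebra ℤ G, (n : AddMonoidAlgebra ℤ G) * x ∈ thI ℤ Θ → x ∈ thI ℤ Θ) :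
    ∃ (J : Type u) (f : J → AddMonoidAlgebra ℤ G) (l : J → (AddMonoidAlgebra ℤ G →ₗ[ℤ] ℤ)),
      (∀ j x, x ∈ thI ℤ Θ → l j x = 0) ∧ (∀ (c : J →₀ ℤ) j, l j (Finsupp.linearCombination ℤ f c) = c j) ∧
      (∀ j k, pr ℤ deg k (f j) = f j ∨ pr ℤ deg k (f j) = 0) ∧
      (∀ x, ∃ u ∈ Submodule.span ℤ (Set.range f), x - u ∈ thI ℤ Θ) := by
  classical
  let C := AddMonoidAlgebra ℤ G ⧸ thI ℤ Θ
  let mk : AddMonoidAlgebra ℤ G →ₗ[ℤ] C := (Ideal.Quotient.mkₐ ℤ (thI ℤ Θ)).toLinearMap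
  have hmk0 : ∀ x, mk x = 0 ↔ x ∈ thI ℤ Θ := fun x => Ideal.Quotient.eq_zero_iff_mem
  have hmks : Function.Surjective mk := Ideal.Quotient.mk_surjective
  -- finiteness
  have hfin : Module.Finite ℤ C := by
    obtain ⟨E, hE⟩ := exists_finite_gen ℤ hΘ hfg
    refine ⟨⟨E.image (fun m => mk (single m 1)), ?_⟩⟩
    rw [eq_top_iff]
    rintro y -
    obtain ⟨x, rfl⟩ := hmks y
    induction x using AddMonoidAlgebra.induction_linear with
    | zero => rw [map_zero]; exact Submodule.zero_mem _
    | add x y hx hy => rw [map_add]; exact Submodule.add_mem _ hx hy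
    | single m r =>
      have h1 : (single m r : AddMonoidAlgebra ℤ G) = r • single m 1 := by simp
      rw [h1, map_smul]
      apply Submodule.smul_mem
      by_cases hm : m ∈ E
      · apply Submodule.subset_span
        simp only [Finset.coe_image]
        exact ⟨m, hm, rfl⟩
      · rw [(hmk0 _).2 (hE m hm)]; exact Submodule.zero_mem _
  have htf1 : ∀ n : ℕ, n ≠ 0 → ∀ y : C, (n : ℤ) • y = 0 → y = 0 := by
    intro n
    induction n using induction_on_primes with
    | zero => intro h; exact (h rfl).elim
    | one => intro _ y h; simpa using h
    | prime_mul p a hp ih =>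
      intro hpa y hy
      have ha : a ≠ 0 := by rintro rfl; simp at hpa
      apply ih ha
      rw [Nat.cast_mul, mul_smul] at hy
      obtain ⟨x, hx⟩ := hmks ((a : ℤ) • y)
      rw [← hx] at hy ⊢
      rw [hmk0]
      apply htf p hp
      rw [← hmk0]
      rw [← map_smul] at hy
      simpa using hy
  have htf2 : Module.IsTorsionFree ℤ C := by
    refine Module.IsTorsionFree.mk ?_
    intro r hr a b hab
    have hr0 : r ≠ 0 := hr.ne_zero
    have h0 : r • (a - b) = 0 := by
      rw [smul_sub, sub_eq_zero]; exact hab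
    have h1 : ((r.natAbs : ℕ) : ℤ) • (a - b) = 0 := by
      rcases Int.natAbs_eq r with h | h
      · rw [← h]; exact h0
      · rw [← neg_neg ((r.natAbs : ℕ) : ℤ), ← h, neg_smul, h0, neg_zero]
    exact sub_eq_zero.1 (htf1 _ (Int.natAbs_ne_zero.2 hr0) _ h1)
  let Cn : ℕ → Submodule ℤ C := fun n => (LinearMap.range (pr ℤ deg n)).map mk
  have hfree : ∀ n, Module.Free ℤ (Cn n) := fun n => Module.free_of_finite_type_torsion_free'
  let b := fun n => Module.Free.chooseBasis ℤ (Cn n)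
  let L : (n : ℕ) → AddMonoidAlgebra ℤ G →ₗ[ℤ] Cn n := fun n =>
    LinearMap.codRestrict (Cn n) (mk ∘ₗ pr ℤ deg n) (fun x => ⟨pr ℤ deg n x, ⟨x, rfl⟩, rfl⟩)
  have hL : ∀ n x, (L n x : C) = mk (pr ℤ deg n x) := fun n x => rfl
  have hlift : ∀ n i, ∃ x, L n x = b n i := by
    intro n i
    obtain ⟨_, ⟨x, rfl⟩, h⟩ := (b n i).2
    exact ⟨x, Subtype.ext h⟩
  choose g hg using hlift
  let J := Σ n, Module.Free.ChooseBasisIndex ℤ (Cn n)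
  let f : J → AddMonoidAlgebra ℤ G := fun j => pr ℤ deg j.1 (g j.1 j.2)
  have hLf : ∀ n i, L n (f ⟨n, i⟩) = b n i := by
    intro n i
    rw [← hg]
    apply Subtype.ext
    rw [hL, hL, pr_pr, if_pos rfl]
  have hLf' : ∀ n j, j.1 ≠ n → L n (f j) = 0 := by
    intro n j hj
    apply Subtype.ext
    rw [hL, pr_pr, if_neg hj, map_zero]
    rfl
  refine ⟨J, f, fun j => (b j.1).coord j.2 ∘ₗ L j.1, ?_, ?_, ?_, ?_⟩
  · intro j x hx
    have : L j.1 x = 0 := Subtype.ext ((hmk0 _).2 (pr_mem_thI ℤ deg hD _ hx))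
    simp [this]
  · intro c j
    induction c using Finsupp.induction_linear with
    | zero => simp
    | add x y hx hy => rw [map_add, map_add, hx, hy]; rfl
    | single j' r =>
      rw [Finsupp.linearCombination_single, map_smul, Finsupp.single_apply]
      obtain ⟨n, i⟩ := j
      obtain ⟨n', i'⟩ := j'
      by_cases hn : n' = n
      · subst hn
        simp only [LinearMap.comp_apply, hLf, Module.Basis.coord_apply, Module.Basis.repr_self, Finsupp.single_apply]
        by_cases hi : i' = i
        · subst hi; simp
        · simp only [hi, if_false]
          rw [if_neg (by intro h; cases h; exact hi rfl)]
          simp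
      · have h1 := hLf' n ⟨n', i'⟩ hn
        simp only [LinearMap.comp_apply, h1]
        rw [if_neg (fun h => hn (congrArg Sigma.fst h))]
        simp
  · intro j k
    simp only [f, pr_pr]
    split_ifs
    · left; rfl
    · right; rfl
  · intro x
    induction x using AddMonoidAlgebra.induction_linear with
    | zero => exact ⟨0, Submodule.zero_mem _, by simp⟩
    | add x y hx hy =>
      obtain ⟨u, hu, h1⟩ := hx
      obtain ⟨v, hv, h2⟩ := hy
      refine ⟨u + v, Submodule.add_mem _ hu hv, ?_⟩
      rw [add_sub_add_comm]
      exact Ideal.add_mem _ h1 h2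
    | single m r =>
      let x : AddMonoidAlgebra ℤ G := single m r
      have hx : pr ℤ deg (deg m) x = x := by simp [x, pr_single]
      refine ⟨∑ i, (b (deg m)).repr (L (deg m) x) i • f ⟨deg m, i⟩, ?_, ?_⟩
      · exact Submodule.sum_mem _ fun i _ => Submodule.smul_mem _ _ (Submodule.subset_span ⟨_, rfl⟩)
      · rw [← hmk0, map_sub, map_sum, sub_eq_zero]
        have h1 := congrArg Subtype.val ((b (deg m)).sum_repr (L (deg m) x))
        rw [hL, hx] at h1
        change mk x = _
        rw [← h1]
        simp only [AddSubmonoidClass.coe_finsetSum, Submodule.coe_smul, map_smul]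
        refine Finset.sum_congr rfl fun i _ => ?_
        rw [← hLf, hL, pr_pr, if_pos rfl]

/-- Freeness over the polynomial ring. -/
lemma free_of_dual (deg : G →+ ℕ) {d D : ℕ} {Θ : Fin d → Finset G} (hD0 : 0 < D)
    (hD : ∀ i, ∀ m ∈ Θ i, deg m = D) {p : ℕ} (hp : p.Prime)
    (hreg : WR d (Ideal.span {(p : AddMonoidAlgebra ℤ G)}) (th ℤ Θ))
    {J : Type*} (f : J → AddMonoidAlgebra ℤ G) (l : J → (AddMonoidAlgebra ℤ G →ₗ[ℤ] ℤ))
    (h1 : ∀ j x, x ∈ thI ℤ Θ → l j x = 0)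
    (h2 : ∀ (c : J →₀ ℤ) j, l j (Finsupp.linearCombination ℤ f c) = c j)
    (h3 : ∀ j k, pr ℤ deg k (f j) = f j ∨ pr ℤ deg k (f j) = 0)
    (h4 : ∀ x, ∃ u ∈ Submodule.span ℤ (Set.range f), x - u ∈ thI ℤ Θ) :
    (phi ℤ Θ).toRingHom.Flat := by
  classical
  let := (phi ℤ Θ).toRingHom.toAlgebra
  have hst : IsScalarTower ℤ (MvPolynomial (Fin d) ℤ) (AddMonoidAlgebra ℤ G) :=
    IsScalarTower.of_algebraMap_eq' (phi ℤ Θ).comp_algebraMap.symm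
  have hX : ∀ i, algebraMap (MvPolynomial (Fin d) ℤ) (AddMonoidAlgebra ℤ G) (MvPolynomial.X i) = th ℤ Θ i := by
    intro i
    change phi ℤ Θ (MvPolynomial.X i) = _
    simp [phi]
  have hspan : Submodule.span (MvPolynomial (Fin d) ℤ) (Set.range f) = ⊤ := by
    rw [← Submodule.restrictScalars_eq_top_iff ℤ]
    refine graded_gen ℤ deg hD0 hD _ (Submodule.span ℤ (Set.range f)) ?_ ?_ h4
    · intro n x hx
      induction hx using Submodule.span_induction with
      | mem x hx =>
        obtain ⟨j, rfl⟩ := hx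
        rcases h3 j n with h | h <;> rw [h]
        · exact Submodule.subset_span ⟨j, rfl⟩
        · exact Submodule.zero_mem _
      | zero => simp
      | add x y _ _ hx hy => rw [map_add]; exact Submodule.add_mem _ hx hy
      | smul a x _ hx => rw [map_smul]; exact Submodule.smul_mem _ _ hx
    · intro i x hx
      rw [← hX, ← Algebra.smul_def]
      exact Submodule.smul_mem (Submodule.span (MvPolynomial (Fin d) ℤ) (Set.range f)) _ hx
  have hPI : PI (p : ℤ) (Ideal.span {(p : AddMonoidAlgebra ℤ G)} ⊔ Ideal.span (Set.range (th ℤ Θ))) f := by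
    intro c hc j
    obtain ⟨u, hu, v, hv, huv⟩ := Submodule.mem_sup.1 hc
    obtain ⟨a, rfl⟩ := Ideal.mem_span_singleton'.1 hu
    rw [← h2 c j, ← huv, map_add, h1 j v hv, add_zero]
    have : a * (p : AddMonoidAlgebra ℤ G) = (p : ℤ) • a := by simp [mul_comm]
    rw [this, map_smul, smul_eq_mul]
    exact dvd_mul_right _ _
  have hPI2 := PI_multi (by simp) _ hreg hPI
  have hregp : ∀ x : AddMonoidAlgebra ℤ G, ((p : ℤ) : AddMonoidAlgebra ℤ G) * x = 0 → x = 0 := by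
    intro x hx
    have hx' : (p : ℤ) • x = 0 := by simpa using hx
    ext m
    have := congrArg (fun z => z.coeff m) hx'
    simp only [coeff_smul, Finsupp.smul_apply, smul_eq_mul] at this
    have hp0 : (p : ℤ) ≠ 0 := by exact_mod_cast hp.ne_zero
    have this' : (p : ℤ) * x.coeff m = 0 := by simpa using this
    rcases mul_eq_zero.1 this' with h | h
    · exact absurd h hp0
    · exact h
  have hli := li_of_PI (p := (p : ℤ)) (by exact_mod_cast hp.one_lt) hregp (by simpa using hPI2)
  have hliB : LinearIndependent (MvPolynomial (Fin d) ℤ) f := by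
    let bb := (MvPolynomial.basisMonomials (Fin d) ℤ).smulTower (Finsupp.basisSingleOne (R := MvPolynomial (Fin d) ℤ) (ι := J))
    let Φ := (Finsupp.linearCombination (MvPolynomial (Fin d) ℤ) f).restrictScalars ℤ
    have hbb : ∀ x, Φ (bb x) = (∏ i, th ℤ Θ i ^ x.1 i) * f x.2 := by
      rintro ⟨α, j⟩
      simp only [Φ, bb, Module.Basis.smulTower_apply, LinearMap.coe_restrictScalars, map_smul, Finsupp.coe_basisSingleOne, Finsupp.linearCombination_single, one_smul, MvPolynomial.coe_basisMonomials]
      rw [Algebra.smul_def]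
      congr 1
      change phi ℤ Θ _ = _
      rw [phi, MvPolynomial.aeval_monomial, map_one, one_mul, Finsupp.prod_fintype _ _ (by simp)]
    have hli2 : LinearIndependent ℤ (fun x => Φ (bb x)) := by
      simp_rw [hbb]
      exact hli.comp (fun x : (Fin d →₀ ℕ) × J => ((x.1 : Fin d → ℕ), x.2)) (by
        rintro ⟨a, j⟩ ⟨b, j'⟩ hab
        simp only [Prod.mk.injEq, DFunLike.coe_fn_eq] at hab
        exact Prod.ext hab.1 hab.2)
    rw [linearIndependent_iff]
    intro c hc
    have hc' : Φ c = 0 := hc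
    rw [← bb.linearCombination_repr c] at hc' ⊢
    rw [Finsupp.apply_linearCombination] at hc'
    rw [linearIndependent_iff.1 hli2 _ hc', map_zero]
  have hb : Module.Free (MvPolynomial (Fin d) ℤ) (AddMonoidAlgebra ℤ G) :=
    Module.Free.of_basis (Module.Basis.mk hliB hspan.ge)
  change Module.Flat _ _
  infer_instance

end dual
end Hochster
namespace Hochster
open AddMonoidAlgebra

section final
universe u

lemma mapRingHom_th {G : Type*} [AddCommMonoid G] {R S : Type*} [CommRing R] [CommRing S] (f : R →+* S)
    {d : ℕ} (Θ : Fin d → Finset G) (i : Fin d) :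
    AddMonoidAlgebra.mapRingHom G f (th R Θ i) = th S Θ i := by
  simp [th]

lemma p_regular {G : Type*} [AddCommMonoid G] {p : ℕ} (hp : p ≠ 0) (x : AddMonoidAlgebra ℤ G)
    (hx : (p : AddMonoidAlgebra ℤ G) * x = 0) : x = 0 := by
  have hx' : (p : ℤ) • x = 0 := by simpa using hx
  ext m
  have := congrArg (fun z => z.coeff m) hx'
  simp only [coeff_smul, Finsupp.smul_apply, smul_eq_mul] at this
  have this' : (p : ℤ) * x.coeff m = 0 := by simpa using this
  rcases mul_eq_zero.1 this' with h | h
  · exact absurd h (by exact_mod_cast hp)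
  · exact h

lemma ker_mod {G : Type*} [AddCommMonoid G] (p : ℕ) (x : AddMonoidAlgebra ℤ G)
    (hx : AddMonoidAlgebra.mapRingHom G (Int.castRingHom (ZMod p)) x = 0) :
    x ∈ Ideal.span {(p : AddMonoidAlgebra ℤ G)} := by
  rw [Ideal.mem_span_singleton]
  refine ⟨ofCoeff (x.coeff.mapRange (fun z => z / (p : ℤ)) (by simp)), ?_⟩
  have h1 : ∀ y : AddMonoidAlgebra ℤ G, (p : AddMonoidAlgebra ℤ G) * y = (p : ℤ) • y := by
    intro y; simp
  rw [h1]
  ext m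
  have h2 := congrArg (fun z => z.coeff m) hx
  simp only [coeff_mapRingHom] at h2
  have h3 : ((x.coeff m : ℤ) : ZMod p) = 0 := by simpa using h2
  rw [ZMod.intCast_zmod_eq_zero_iff_dvd] at h3
  simp only [coeff_smul, Finsupp.smul_apply, smul_eq_mul]
  simp [Int.mul_ediv_cancel' h3]

lemma WR_mod {s : ℕ} (N : AddSubmonoid (Fin s → ℕ))
    (hfull : ∀ a ∈ N, ∀ b ∈ N, b ≤ a → a - b ∈ N) (p : ℕ) [Fact p.Prime]
    (Θ : Fin (rk N) → Finset N) (hfin : (phi (ZMod p) Θ).toRingHom.Finite) :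
    WR (rk N) (Ideal.span {(p : AddMonoidAlgebra ℤ N)}) (th ℤ Θ) := by
  apply WR_of_colon
  intro t k hk x hx
  let π := AddMonoidAlgebra.mapRingHom N (Int.castRingHom (ZMod p))
  have hπ : Function.Surjective π :=
    AddMonoidAlgebra.map_surjective (Int.castRingHom (ZMod p)).toAddMonoidHom ZMod.intCast_surjective
  have himg : (Ideal.span (th ℤ Θ '' (t : Set (Fin (rk N))))).map π =
      Ideal.span (th (ZMod p) Θ '' (t : Set (Fin (rk N)))) := by
    rw [Ideal.map_span, ← Set.image_comp]
    congr 1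
    refine Set.image_congr fun i _ => ?_
    exact mapRingHom_th _ _ _
  have hp0 : π (p : AddMonoidAlgebra ℤ N) = 0 := by
    rw [map_natCast]
    have h := map_natCast (algebraMap (ZMod p) (AddMonoidAlgebra (ZMod p) N)) p
    rw [← h]; simp
  have h1 : π (th ℤ Θ k * x) ∈ Ideal.span (th (ZMod p) Θ '' (t : Set (Fin (rk N)))) := by
    have h2 := Ideal.mem_map_of_mem π hx
    rw [Ideal.map_sup, Ideal.map_span, Set.image_singleton, hp0, himg] at h2
    simpa using h2
  rw [map_mul] at h1
  have h2 := theta_colon hfull p Θ hfin (phi_injective N (ZMod p) Θ hfin) t k hk (π x)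
    (by rw [← mapRingHom_th (Int.castRingHom (ZMod p))]; exact h1)
  rw [← himg, Ideal.mem_map_iff_of_surjective π hπ] at h2
  obtain ⟨y, hy, hyx⟩ := h2
  have h3 : x - y ∈ Ideal.span {(p : AddMonoidAlgebra ℤ N)} := by
    apply ker_mod
    change π (x - y) = 0
    rw [map_sub, hyx, sub_self]
  have h4 : x = (x - y) + y := by ring
  rw [h4]
  exact Submodule.add_mem_sup h3 hy

/-- The degree homomorphism. -/
def dgHom {s : ℕ} (N : AddSubmonoid (Fin s → ℕ)) : N →+ ℕ where
  toFun m := dg (m : Fin s → ℕ)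
  map_zero' := by simp [dg]
  map_add' a b := by simp [dg_add]

lemma flat_int {s : ℕ} (N : AddSubmonoid (Fin s → ℕ))
    (hfull : ∀ a ∈ N, ∀ b ∈ N, b ≤ a → a - b ∈ N) (hfg : AddMonoid.FG N) {D : ℕ} (hD0 : 0 < D)
    (Θ : Fin (rk N) → Finset N) (hD : ∀ i, ∀ m ∈ Θ i, dgHom N m = D) (hΘ : FaceCond Θ) :
    (phi ℤ Θ).toRingHom.Flat := by
  have hWR : ∀ p : ℕ, p.Prime → WR (rk N) (Ideal.span {(p : AddMonoidAlgebra ℤ N)}) (th ℤ Θ) := by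
    intro p hp
    have : Fact p.Prime := ⟨hp⟩
    exact WR_mod N hfull p Θ (phi_finite (ZMod p) (dgHom N) hD0 hD hΘ hfg)
  obtain ⟨J, f, l, h1, h2, h3, h4⟩ := exists_dual (dgHom N) hD hΘ hfg (by
    intro p hp x hx
    have h := WR_p ⊥ (th ℤ Θ) (p : AddMonoidAlgebra ℤ N)
      (fun y hy => by
        rw [Ideal.mem_bot] at hy ⊢
        exact p_regular hp.ne_zero y hy) (by rw [bot_sup_eq]; exact hWR p hp) x
    rw [bot_sup_eq] at h
    exact h hx)
  exact free_of_dual (dgHom N) hD0 hD Nat.prime_two (hWR 2 Nat.prime_two) f l h1 h2 h3 h4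

lemma flat_base {G : Type*} [AddCommMonoid G] {d : ℕ} (Θ : Fin d → Finset G)
    (h : (phi ℤ Θ).toRingHom.Flat) (R : Type*) [CommRing R] : (phi R Θ).toRingHom.Flat := by
  let a1 : Algebra (MvPolynomial (Fin d) ℤ) (AddMonoidAlgebra ℤ G) := (phi ℤ Θ).toRingHom.toAlgebra
  let a2 : Algebra (MvPolynomial (Fin d) R) (AddMonoidAlgebra R G) := (phi R Θ).toRingHom.toAlgebra
  let a3 : Algebra (MvPolynomial (Fin d) ℤ) (MvPolynomial (Fin d) R) := MvPolynomial.algebraMvPolynomial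
  let a4 : Algebra (AddMonoidAlgebra ℤ G) (AddMonoidAlgebra R G) := AddMonoidAlgebra.algebraAddMonoidAlgebra
  let a5 : Algebra (MvPolynomial (Fin d) ℤ) (AddMonoidAlgebra R G) :=
    ((algebraMap (AddMonoidAlgebra ℤ G) (AddMonoidAlgebra R G)).comp (phi ℤ Θ).toRingHom).toAlgebra
  have s1 : IsScalarTower (MvPolynomial (Fin d) ℤ) (AddMonoidAlgebra ℤ G) (AddMonoidAlgebra R G) :=
    IsScalarTower.of_algebraMap_eq' rfl
  have s2 : IsScalarTower (MvPolynomial (Fin d) ℤ) (MvPolynomial (Fin d) R) (AddMonoidAlgebra R G) := by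
    apply IsScalarTower.of_algebraMap_eq'
    apply MvPolynomial.ringHom_ext
    · intro r; simp
    · intro i
      change AddMonoidAlgebra.mapRingHom G (algebraMap ℤ R) (phi ℤ Θ (MvPolynomial.X i)) =
        phi R Θ (MvPolynomial.map (algebraMap ℤ R) (MvPolynomial.X i))
      simp only [phi, MvPolynomial.map_X, MvPolynomial.aeval_X]
      exact mapRingHom_th _ _ _
  have s3 : IsScalarTower R (MvPolynomial (Fin d) R) (AddMonoidAlgebra R G) :=
    IsScalarTower.of_algebraMap_eq' (phi R Θ).comp_algebraMap.symm
  have p1 : Algebra.IsPushout ℤ (MvPolynomial (Fin d) ℤ) R (MvPolynomial (Fin d) R) := inferInstance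
  have p2 : Algebra.IsPushout ℤ (AddMonoidAlgebra ℤ G) R (AddMonoidAlgebra R G) := inferInstance
  have p3 : Algebra.IsPushout (MvPolynomial (Fin d) ℤ) (AddMonoidAlgebra ℤ G)
      (MvPolynomial (Fin d) R) (AddMonoidAlgebra R G) :=
    (Algebra.IsPushout.comp_iff ℤ (MvPolynomial (Fin d) ℤ) R (MvPolynomial (Fin d) R)).1 p2
  have hfl : Module.Flat (MvPolynomial (Fin d) ℤ) (AddMonoidAlgebra ℤ G) := h
  exact Module.Flat.isBaseChange (MvPolynomial (Fin d) ℤ) (MvPolynomial (Fin d) R) (AddMonoidAlgebra ℤ G) (AddMonoidAlgebra R G) p3.symm.out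

end final
end Hochster

namespace Hochster

lemma cm_full {s : ℕ} (N : AddSubmonoid (Fin s → ℕ))
    (hfull : ∀ a ∈ N, ∀ b ∈ N, b ≤ a → a - b ∈ N) (hfg : AddMonoid.FG N)
    {R : Type*} [CommRing R] [IsNoetherianRing R] (hR : IsCohenMacaulayRing R) :
    IsCohenMacaulayRing (AddMonoidAlgebra R N) := by
  obtain ⟨D, hD0, Θ, hD, hΘ⟩ := exists_theta N hfull
  have hD' : ∀ i, ∀ m ∈ Θ i, dgHom N m = D := hD
  have hfl := flat_base Θ (flat_int N hfull hfg hD0 Θ hD' hΘ) R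
  have hfi := phi_finite R (dgHom N) hD0 hD' hΘ hfg
  let := (phi R Θ).toRingHom.toAlgebra
  have h1 : Module.Flat (MvPolynomial (Fin (rk N)) R) (AddMonoidAlgebra R N) := hfl
  have h2 : Module.Finite (MvPolynomial (Fin (rk N)) R) (AddMonoidAlgebra R N) := hfi
  have h3 : IsNoetherianRing (AddMonoidAlgebra R N) :=
    IsNoetherianRing.of_finite (MvPolynomial (Fin (rk N)) R) _
  exact cm_of_flat_integral (S := MvPolynomial (Fin (rk N)) R) (cm_mvPolynomial hR _)

end Hochster

/-- Hochster's theorem: if `R` is a Cohen–Macaulay noetherian ring and `M` a fine, sharp and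
saturated monoid, then the monoid algebra `R[M]` is Cohen–Macaulay. -/
theorem stmt11 {R : Type*} (M : Type*) [CommRing R] [IsNoetherianRing R]
    (hR : IsCohenMacaulayRing R) [CancelCommMonoid M] (hfg : Monoid.FG M)
    (hsharp : ∀ x : M, IsUnit x → x = 1) (hsat : IsSaturatedMonoid M) :
    IsCohenMacaulayRing (MonoidAlgebra R M) := by
  have hfgA : AddMonoid.FG (Additive M) := Monoid.fg_iff_add_fg.1 hfg
  obtain ⟨s, N, hfull, ⟨e⟩⟩ := Hochster.exists_full_embedding (A := Additive M) hfgA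
    (fun x y h => hsharp x.toMul (IsUnit.of_mul_eq_one y.toMul h))
    (fun a b n hn h => hsat a.toMul b.toMul n hn h)
  have hfgN : AddMonoid.FG N := AddMonoid.fg_of_surjective e.toAddMonoidHom e.surjective
  have h := Hochster.cm_full N hfull hfgN hR
  exact Hochster.cm_of_ringEquiv
    ((AddMonoidAlgebra.mapDomainRingEquiv R e).symm.trans (MonoidAlgebra.toAdditive R M).symm) h
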